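/- arXiv:1710.08486 — 2 statements merged into one kernel-verified Lean document; each statement's English description precedes it below -/
import Mathlib

section
/- For every ε > 0 there exists N such that every simple graph G on n ≥ N vertices satisfies π₃(G) ≤ π_{3,f}(G) + ε·n²; that is, π₃(G) ≤ π_{3,f}(G) + o(n²) for every n-vertex graph G. -/
open Finset

/-- `D = (C_1, …, C_ℓ)` is a decomposition of the edges of `G` into complete subgraphs:
each part is a clique of `G` with at least two vertices, and every edge of `G`
lies in exactly one part. -/
def IsCliqueDecomp {V : Type*} (G : SimpleGraph V) {ℓ : ℕ} (D : Fin ℓ → Finset V) : Prop :=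
  (∀ i, G.IsClique (D i : Set V) ∧ 2 ≤ (D i).card) ∧
  ∀ u v : V, G.Adj u v → ∃! i, u ∈ D i ∧ v ∈ D i

/-- `π_k(G)`: the minimum of `|C₁| + ⋯ + |C_ℓ|` over all decompositions of the edges of
`G` into complete graphs of order at most `k`. -/
noncomputable def piInt {V : Type*} (G : SimpleGraph V) (k : ℕ) : ℕ :=
  sInf { m | ∃ (ℓ : ℕ) (D : Fin ℓ → Finset V), IsCliqueDecomp G D ∧
    (∀ i, (D i).card ≤ k) ∧ ∑ i, (D i).card = m }

/-- `w` is a fractional `k`-decomposition of `G`. -/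
def IsFracDecomp {V : Type*} [Fintype V] [DecidableEq V] (G : SimpleGraph V) (k : ℕ)
    (w : Finset V → ℝ) : Prop :=
  (∀ C, 0 ≤ w C) ∧
  (∀ C : Finset V, w C ≠ 0 → G.IsClique (C : Set V) ∧ C.card ≤ k) ∧
  ∀ u v : V, G.Adj u v → ∑ C ∈ univ.filter (fun C : Finset V => u ∈ C ∧ v ∈ C), w C = 1

/-- The weight of a fractional decomposition. -/
noncomputable def fracWeight {V : Type*} [Fintype V] [DecidableEq V]
    (w : Finset V → ℝ) : ℝ :=
  ∑ C : Finset V, w C * C.card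

/-- `π_{k,f}(G)`: the minimum weight of a fractional `k`-decomposition of `G`. -/
noncomputable def piFrac {V : Type*} [Fintype V] [DecidableEq V]
    (G : SimpleGraph V) (k : ℕ) : ℝ :=
  sInf { x | ∃ w, IsFracDecomp G k w ∧ fracWeight w = x }

lemma one_sub_sum_le_prod_one_sub {ι : Type*} [DecidableEq ι] {p : ι → ℝ} (h0 : ∀ i, 0 ≤ p i)
    (h1 : ∀ i, p i ≤ 1) (A : Finset ι) : 1 - ∑ i ∈ A, p i ≤ ∏ i ∈ A, (1 - p i) := by
  induction A using Finset.induction_on with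
  | empty => simp
  | insert a s ha ih =>
    rw [sum_insert ha, prod_insert ha]
    have hs : ∏ i ∈ s, (1 - p i) ≤ 1 :=
      prod_le_one (fun i _ => sub_nonneg.2 (h1 i)) fun i _ => by linarith [h0 i]
    nlinarith [h0 a]

section RandomSubset

variable {ι : Type*} [Fintype ι] [DecidableEq ι]

/-- The expectation of `F S`, where `S` contains each `i` independently with probability `p i`. -/
noncomputable def subsetExp (p : ι → ℝ) (F : Finset ι → ℝ) : ℝ :=
  ∑ S : Finset ι, ((∏ i ∈ S, p i) * ∏ i ∈ Sᶜ, (1 - p i)) * F S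

lemma subsetExp_disjoint (p : ι → ℝ) (A : Finset ι) :
    subsetExp p (fun S => if Disjoint S A then 1 else 0) = ∏ i ∈ A, (1 - p i) := by
  have h := Fintype.prod_add (fun i => if i ∉ A then p i else 0) (fun i => 1 - p i)
  have h1 : ∀ i, (if i ∉ A then p i else 0) + (1 - p i) = if i ∈ A then 1 - p i else 1 := by
    intro i; split_ifs <;> first | contradiction | ring
  simp only [h1, prod_ite_mem, univ_inter, prod_ite_zero] at h
  rw [h, subsetExp]
  refine sum_congr rfl fun S _ => ?_
  simp only [disjoint_left]
  split_ifs <;> ring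

lemma subsetExp_const (p : ι → ℝ) (c : ℝ) : subsetExp p (fun _ => c) = c := by
  have h := subsetExp_disjoint p ∅
  simp only [disjoint_empty_right, if_true, prod_empty, subsetExp, mul_one] at h
  simp only [subsetExp, ← sum_mul, h, one_mul]

lemma subsetExp_add (p : ι → ℝ) (F F' : Finset ι → ℝ) :
    subsetExp p (fun S => F S + F' S) = subsetExp p F + subsetExp p F' := by
  simp only [subsetExp, mul_add, sum_add_distrib]

lemma subsetExp_sub (p : ι → ℝ) (F F' : Finset ι → ℝ) :
    subsetExp p (fun S => F S - F' S) = subsetExp p F - subsetExp p F' := by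
  simp only [subsetExp, mul_sub, sum_sub_distrib]

lemma subsetExp_const_mul (p : ι → ℝ) (c : ℝ) (F : Finset ι → ℝ) :
    subsetExp p (fun S => c * F S) = c * subsetExp p F := by
  simp only [subsetExp, mul_sum]
  exact sum_congr rfl fun S _ => by ring

lemma subsetExp_sum {κ : Type*} (p : ι → ℝ) (s : Finset κ) (F : κ → Finset ι → ℝ) :
    subsetExp p (fun S => ∑ k ∈ s, F k S) = ∑ k ∈ s, subsetExp p (F k) := by
  simp only [subsetExp, mul_sum]
  exact sum_comm

lemma subsetExp_mono {p : ι → ℝ} (h0 : ∀ i, 0 ≤ p i) (h1 : ∀ i, p i ≤ 1) {F F' : Finset ι → ℝ}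
    (h : ∀ S, F S ≤ F' S) : subsetExp p F ≤ subsetExp p F' := by
  refine sum_le_sum fun S _ => mul_le_mul_of_nonneg_left (h S) ?_
  exact mul_nonneg (prod_nonneg fun i _ => h0 i) (prod_nonneg fun i _ => sub_nonneg.2 (h1 i))

lemma exists_le_of_le_subsetExp {p : ι → ℝ} (h0 : ∀ i, 0 ≤ p i) (h1 : ∀ i, p i ≤ 1)
    {F : Finset ι → ℝ} {c : ℝ} (h : c ≤ subsetExp p F) : ∃ S, c ≤ F S := by
  obtain ⟨S, -, hS⟩ := exists_max_image univ F univ_nonempty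
  refine ⟨S, h.trans ?_⟩
  exact (subsetExp_mono h0 h1 fun S' => hS S' (mem_univ _)).trans_eq (subsetExp_const p (F S))

lemma subsetExp_mem_disjoint (p : ι → ℝ) {i : ι} {A : Finset ι} (hi : i ∉ A) :
    subsetExp p (fun S => if i ∈ S ∧ Disjoint S A then 1 else 0) = p i * ∏ j ∈ A, (1 - p j) := by
  have h : ∀ S : Finset ι, (if i ∈ S ∧ Disjoint S A then (1 : ℝ) else 0)
      = (if Disjoint S A then 1 else 0) - if Disjoint S (insert i A) then 1 else 0 := by
    intro S
    by_cases h1 : i ∈ S <;> by_cases h2 : Disjoint S A <;> simp [h1, h2]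
  simp only [h]
  rw [subsetExp_sub, subsetExp_disjoint, subsetExp_disjoint, prod_insert hi]
  ring

end RandomSubset

section Nibble

variable {E ι : Type*} [Fintype E] [DecidableEq E] [Fintype ι] [DecidableEq ι]

/-- The total weight of the hyperedges through a vertex. -/
def load (t : ι → Finset E) (w : ι → ℝ) (e : E) : ℝ := ∑ i with e ∈ t i, w i

/-- `t` is a 3-uniform linear hypergraph. -/
def IsLinearTriple (t : ι → Finset E) : Prop :=
  (∀ i, #(t i) = 3) ∧ ∀ i j, i ≠ j → ∀ e ∈ t i, ∀ f ∈ t i, e ∈ t j → f ∈ t j → e = f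

/-- `w` is a fractional matching of the hypergraph `t`. -/
def IsFracMatching (t : ι → Finset E) (w : ι → ℝ) : Prop :=
  (∀ i, 0 ≤ w i) ∧ ∀ e, load t w e ≤ 1

/-- The hyperedges meeting a given one. -/
def touching (t : ι → Finset E) (i : ι) : Finset ι := {j | ¬ Disjoint (t j) (t i)}

omit [DecidableEq ι] in
lemma sum_mul_load (t : ι → Finset E) (w : ι → ℝ) (g : E → ℝ) :
    ∑ e, g e * load t w e = ∑ i, w i * ∑ e ∈ t i, g e := by
  simp only [load, mul_sum, sum_filter]
  rw [sum_comm]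
  refine sum_congr rfl fun i _ => ?_
  simp only [mul_ite, mul_zero, ← sum_filter, filter_mem_eq_inter, univ_inter]
  exact sum_congr rfl fun e _ => mul_comm _ _

omit [Fintype E] [DecidableEq ι] in
lemma load_nonneg {t : ι → Finset E} {w : ι → ℝ} (h : ∀ i, 0 ≤ w i) (e : E) :
    0 ≤ load t w e := sum_nonneg fun i _ => h i

omit [Fintype E] [DecidableEq ι] in
lemma load_const_mul (t : ι → Finset E) (w : ι → ℝ) (a : ℝ) (e : E) :
    load t (fun i => a * w i) e = a * load t w e := by
  simp only [load, mul_sum]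

omit [DecidableEq ι] in
/-- A weight function can be decreased to a fractional matching, losing at most its total
excess. -/
lemma exists_isFracMatching_le (t : ι → Finset E) {w : ι → ℝ} (hw : ∀ i, 0 ≤ w i) :
    ∃ v, IsFracMatching t v ∧ (∀ i, v i ≤ w i) ∧
      ∑ i, w i - ∑ e, max (load t w e - 1) 0 ≤ ∑ i, v i := by
  set g : E → ℝ := fun e => (max 1 (load t w e))⁻¹ with hg
  have hm : ∀ e, (1 : ℝ) ≤ max 1 (load t w e) := fun e => le_max_left _ _
  have g0 : ∀ e, 0 ≤ g e := fun e => inv_nonneg.2 (zero_le_one.trans (hm e))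
  have g1 : ∀ e, g e ≤ 1 := fun e => inv_le_one_of_one_le₀ (hm e)
  have hp1 : ∀ i, ∏ e ∈ t i, g e ≤ 1 := fun i => prod_le_one (fun e _ => g0 e) fun e _ => g1 e
  refine ⟨fun i => w i * ∏ e ∈ t i, g e,
    ⟨fun i => mul_nonneg (hw i) (prod_nonneg fun e _ => g0 e), fun e => ?_⟩,
    fun i => mul_le_of_le_one_right (hw i) (hp1 i), ?_⟩
  · have h1 : load t (fun i => w i * ∏ e ∈ t i, g e) e ≤ g e * load t w e := by
      rw [load, load, mul_sum]
      refine sum_le_sum fun i hi => ?_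
      rw [mul_comm (g e)]
      refine mul_le_mul_of_nonneg_left ?_ (hw i)
      rw [← mul_prod_erase _ _ (mem_filter.1 hi).2]
      exact mul_le_of_le_one_right (g0 e) (prod_le_one (fun e _ => g0 e) fun e _ => g1 e)
    refine h1.trans ?_
    rw [hg, inv_mul_le_iff₀ (zero_lt_one.trans_le (hm e)), mul_one]
    exact le_max_right _ _
  · have h1 : ∀ i, w i - w i * ∑ e ∈ t i, (1 - g e) ≤ w i * ∏ e ∈ t i, g e := by
      intro i
      have := one_sub_sum_le_prod_one_sub (p := fun e => 1 - g e) (fun e => sub_nonneg.2 (g1 e))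
        (fun e => by linarith [g0 e]) (t i)
      simp only [sub_sub_cancel] at this
      nlinarith [hw i]
    have h2 := sum_le_sum fun i (_ : i ∈ univ) => h1 i
    rw [sum_sub_distrib, ← sum_mul_load] at h2
    refine le_trans (sub_le_sub_left (sum_le_sum fun e _ => ?_) _) h2
    rcases le_total (load t w e) 1 with h | h
    · simp [hg, max_eq_left h]
    · have : 0 < load t w e := by linarith
      rw [hg]
      simp only [max_eq_right h]
      rw [sub_mul, inv_mul_cancel₀ this.ne', one_mul]
      exact le_max_left _ _

omit [Fintype E] in
lemma card_touching_inter_sdiff_le {t : ι → Finset E} (ht : IsLinearTriple t) {i j : ι}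
    (hij : i ≠ j) {e : E} (hi : e ∈ t i) (hj : e ∈ t j) :
    #((touching t i ∩ touching t j) \ ({k | e ∈ t k} : Finset ι)) ≤ 4 := by
  have hsub : (touching t i ∩ touching t j) \ ({k | e ∈ t k} : Finset ι) ⊆
      ((t i).erase e ×ˢ (t j).erase e).biUnion
        fun q => ({k | q.1 ∈ t k ∧ q.2 ∈ t k} : Finset ι) := by
    intro k hk
    simp only [touching, mem_sdiff, mem_inter, mem_filter, mem_univ, true_and,
      not_disjoint_iff] at hk
    obtain ⟨⟨⟨f, hf, hfi⟩, g, hg, hgj⟩, hek⟩ := hk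
    simp only [mem_biUnion, mem_product, mem_erase, mem_filter, mem_univ, true_and]
    exact ⟨(f, g), ⟨⟨fun h => hek (h ▸ hf), hfi⟩, fun h => hek (h ▸ hg), hgj⟩, hf, hg⟩
  refine (card_le_card hsub).trans ((card_biUnion_le_card_mul _ _ 1 fun q hq => ?_).trans ?_)
  · simp only [mem_product, mem_erase] at hq
    refine card_le_one.2 fun k hk l hl => ?_
    simp only [mem_filter, mem_univ, true_and] at hk hl
    by_contra hkl
    have h1 := ht.2 k l hkl _ hk.1 _ hk.2 hl.1 hl.2
    exact hq.1.1 (ht.2 i j hij _ hq.1.2 _ hi (h1 ▸ hq.2.2) hj)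
  · rw [card_product, card_erase_of_mem hi, card_erase_of_mem hj, ht.1, ht.1]

omit [Fintype E] [DecidableEq ι] in
lemma sum_touching_le (t : ι → Finset E) {w : ι → ℝ} (hw : IsFracMatching t w) (i : ι) :
    ∑ j ∈ touching t i, w j ≤ #(t i) := by
  have h : ∑ e ∈ t i, load t w e = ∑ j, ∑ e ∈ t i, if e ∈ t j then w j else 0 := by
    simp only [load, sum_filter]
    exact sum_comm
  calc ∑ j ∈ touching t i, w j
      ≤ ∑ e ∈ t i, load t w e := by
        rw [h, touching, sum_filter]
        refine sum_le_sum fun j _ => ?_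
        have h0 : ∀ e ∈ t i, 0 ≤ if e ∈ t j then w j else 0 := fun e _ => by
          split_ifs <;> simp [hw.1]
        by_cases hj : Disjoint (t j) (t i)
        · rw [if_neg (not_not.2 hj)]
          exact sum_nonneg h0
        · rw [if_pos hj]
          obtain ⟨f, hf, hfi⟩ := not_disjoint_iff.1 hj
          exact (if_pos hf).symm.le.trans (single_le_sum h0 hfi)
    _ ≤ ∑ e ∈ t i, 1 := sum_le_sum fun e _ => hw.2 e
    _ = #(t i) := by simp

/-- The weights surviving after a random set `S` of hyperedges, containing each `i` with
probability `θ * w i`, has been selected: hyperedges touching `S` are removed and the others are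
rescaled. -/
noncomputable def survivingWeight (t : ι → Finset E) (w : ι → ℝ) (θ : ℝ) (S : Finset ι)
    (i : ι) : ℝ :=
  (1 - θ) / (∏ j ∈ touching t i, (1 - θ * w j)) * w i *
    if Disjoint S (touching t i) then 1 else 0

omit [Fintype E] [DecidableEq ι] in
lemma through_subset_touching {t : ι → Finset E} {i : ι} {e : E} (hi : e ∈ t i) :
    ({k | e ∈ t k} : Finset ι) ⊆ touching t i := by
  intro k hk
  simp only [mem_filter, mem_univ, true_and] at hk
  simpa [touching, not_disjoint_iff] using ⟨e, hk, hi⟩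

section Step

variable {t : ι → Finset E} {w : ι → ℝ} {θ c : ℝ}

omit [Fintype E] in
lemma one_sub_le_prod_touching (ht : IsLinearTriple t) (hw : IsFracMatching t w)
    (h1 : ∀ i, w i ≤ 1) (hθ : 0 ≤ θ) (hθ1 : θ ≤ 1) (i : ι) :
    1 - 3 * θ ≤ ∏ j ∈ touching t i, (1 - θ * w j) := by
  refine le_trans ?_ (one_sub_sum_le_prod_one_sub (fun j => mul_nonneg hθ (hw.1 j))
    (fun j => mul_le_one₀ hθ1 (hw.1 j) (h1 j)) _)
  have := sum_touching_le t hw i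
  rw [ht.1] at this
  push_cast at this
  rw [← mul_sum]
  nlinarith

omit [Fintype E] in
lemma one_sub_le_prod_through (hw : IsFracMatching t w)
    (h1 : ∀ i, w i ≤ 1) (hθ : 0 ≤ θ) (hθ1 : θ ≤ 1) (e : E) :
    1 - θ ≤ ∏ j with e ∈ t j, (1 - θ * w j) := by
  refine le_trans ?_ (one_sub_sum_le_prod_one_sub (fun j => mul_nonneg hθ (hw.1 j))
    (fun j => mul_le_one₀ hθ1 (hw.1 j) (h1 j)) _)
  have := hw.2 e
  rw [← mul_sum]
  rw [load] at this
  nlinarith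

omit [Fintype E] in
lemma subsetExp_survivingWeight (hx : ∀ i, 0 < ∏ j ∈ touching t i, (1 - θ * w j)) (i : ι) :
    subsetExp (fun j => θ * w j) (fun S => survivingWeight t w θ S i) = (1 - θ) * w i := by
  simp only [survivingWeight]
  rw [subsetExp_const_mul, subsetExp_disjoint]
  have := (hx i).ne'
  field_simp

omit [Fintype E] in
lemma subsetExp_survivingWeight_mul_le (ht : IsLinearTriple t) (hw : IsFracMatching t w)
    (hc : ∀ i, w i ≤ c) (hc8 : c ≤ 1 / 8) (hθ : 0 ≤ θ) (hθ1 : θ ≤ 1 / 6)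
    {e : E} {i j : ι} (hi : e ∈ t i) (hj : e ∈ t j) (hij : i ≠ j) :
    subsetExp (fun j => θ * w j) (fun S => survivingWeight t w θ S i * survivingWeight t w θ S j)
      ≤ (1 - θ) ^ 2 / ((∏ k with e ∈ t k, (1 - θ * w k)) * (1 - 4 * c)) * (w i * w j) := by
  have h1 : ∀ i, w i ≤ 1 := fun i => (hc i).trans (by linarith)
  have hc0 : 0 ≤ c := (hw.1 i).trans (hc i)
  have hx : ∀ i, 0 < ∏ j ∈ touching t i, (1 - θ * w j) := fun i =>
    lt_of_lt_of_le (by linarith) (one_sub_le_prod_touching ht hw h1 hθ (by linarith) i)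
  have hs : 0 < ∏ k with e ∈ t k, (1 - θ * w k) :=
    lt_of_lt_of_le (by linarith) (one_sub_le_prod_through hw h1 hθ (by linarith) e)
  have hp0 : ∀ k, 0 ≤ θ * w k := fun k => mul_nonneg hθ (hw.1 k)
  have hp1 : ∀ k, θ * w k ≤ 1 := fun k => mul_le_one₀ (by linarith) (hw.1 k) (h1 k)
  have hprod : ∀ S : Finset ι, survivingWeight t w θ S i * survivingWeight t w θ S j =
      ((1 - θ) ^ 2 * (w i * w j) / ((∏ k ∈ touching t i, (1 - θ * w k)) *
        ∏ k ∈ touching t j, (1 - θ * w k))) *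
        if Disjoint S (touching t i ∪ touching t j) then 1 else 0 := by
    intro S
    have hxi := (hx i).ne'
    have hxj := (hx j).ne'
    by_cases h : Disjoint S (touching t i) <;> by_cases h' : Disjoint S (touching t j) <;>
      simp only [survivingWeight, h, h', disjoint_union_right, and_self, and_true, and_false,
        if_true, if_false, mul_one, mul_zero, zero_mul]
    field_simp
  simp only [hprod]
  rw [subsetExp_const_mul, subsetExp_disjoint, ← prod_union_inter]
  have hinter : (∏ k with e ∈ t k, (1 - θ * w k)) * (1 - 4 * c)
      ≤ ∏ k ∈ touching t i ∩ touching t j, (1 - θ * w k) := by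
    rw [← prod_sdiff (subset_inter (through_subset_touching hi) (through_subset_touching hj)),
      mul_comm]
    refine mul_le_mul_of_nonneg_right ?_ hs.le
    refine le_trans ?_ (one_sub_sum_le_prod_one_sub hp0 hp1 _)
    have h4 : (#((touching t i ∩ touching t j) \ ({k | e ∈ t k} : Finset ι)) : ℝ) ≤ 4 := by
      exact_mod_cast card_touching_inter_sdiff_le ht hij hi hj
    have := sum_le_card_nsmul ((touching t i ∩ touching t j) \ ({k | e ∈ t k} : Finset ι))
      (fun k => θ * w k) c fun k _ => by nlinarith [hw.1 k, hc k]
    rw [nsmul_eq_mul] at this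
    nlinarith
  have hpos : 0 < (∏ k with e ∈ t k, (1 - θ * w k)) * (1 - 4 * c) := mul_pos hs (by linarith)
  have hU : 0 < ∏ k ∈ touching t i ∪ touching t j, (1 - θ * w k) := by
    refine prod_pos fun k _ => ?_
    nlinarith [hw.1 k, h1 k]
  have hI := hpos.trans_le hinter
  have hww := mul_nonneg (hw.1 i) (hw.1 j)
  calc _ = (1 - θ) ^ 2 / (∏ k ∈ touching t i ∩ touching t j, (1 - θ * w k)) * (w i * w j) := by
        field_simp
    _ ≤ _ := by gcongr

omit [Fintype E] in
lemma subsetExp_excess_le (ht : IsLinearTriple t) (hw : IsFracMatching t w)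
    (hc : ∀ i, w i ≤ c) (hc0 : 0 ≤ c) (hc8 : c ≤ 1 / 8) (hθ : 0 ≤ θ) (hθ1 : θ ≤ 1 / 6)
    {η : ℝ} (hη : 0 < η) (e : E) :
    subsetExp (fun j => θ * w j) (fun S => max (load t (survivingWeight t w θ S) e - 1) 0)
      ≤ 10 * c / η + η := by
  have h1 : ∀ i, w i ≤ 1 := fun i => (hc i).trans (by linarith)
  have hx : ∀ i, 1 / 2 ≤ ∏ j ∈ touching t i, (1 - θ * w j) := fun i =>
    le_trans (by linarith) (one_sub_le_prod_touching ht hw h1 hθ (by linarith) i)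
  have hx0 : ∀ i, 0 < ∏ j ∈ touching t i, (1 - θ * w j) := fun i =>
    lt_of_lt_of_le (by norm_num) (hx i)
  have hp0 : ∀ k, 0 ≤ θ * w k := fun k => mul_nonneg hθ (hw.1 k)
  have hp1 : ∀ k, θ * w k ≤ 1 := fun k => mul_le_one₀ (by linarith) (hw.1 k) (h1 k)
  have hs := one_sub_le_prod_through hw h1 hθ (by linarith) e
  set s := ∏ k with e ∈ t k, (1 - θ * w k) with hsdef
  have hs0 : 0 < s := lt_of_lt_of_le (by linarith) hs
  set D := load t w e with hD
  have hD0 : 0 ≤ D := load_nonneg hw.1 e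
  have hD1 : D ≤ 1 := hw.2 e
  set μ := (1 - θ) * D / s with hμ
  have hμ1 : μ ≤ 1 := by
    rw [hμ, div_le_one hs0]
    nlinarith
  have hfirst : subsetExp (fun j => θ * w j) (fun S => load t (survivingWeight t w θ S) e)
      = (1 - θ) * D := by
    simp only [load]
    rw [subsetExp_sum, hD, load, mul_sum]
    exact sum_congr rfl fun i _ => subsetExp_survivingWeight hx0 i
  have hsecond : subsetExp (fun j => θ * w j)
      (fun S => load t (survivingWeight t w θ S) e * load t (survivingWeight t w θ S) e)
      ≤ (1 - θ) ^ 2 / (s * (1 - 4 * c)) * D ^ 2 + 2 * c := by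
    simp only [load, sum_mul_sum]
    rw [subsetExp_sum]
    simp only [subsetExp_sum]
    have hterm : ∀ i ∈ ({i | e ∈ t i} : Finset ι), ∀ j ∈ ({i | e ∈ t i} : Finset ι),
        subsetExp (fun j => θ * w j)
          (fun S => survivingWeight t w θ S i * survivingWeight t w θ S j)
        ≤ (1 - θ) ^ 2 / (s * (1 - 4 * c)) * (w i * w j) + if i = j then 2 * c * w i else 0 := by
      intro i hi j hj
      simp only [mem_filter, mem_univ, true_and] at hi hj
      split_ifs with hij
      · subst hij
        have hsq : ∀ S : Finset ι, survivingWeight t w θ S i * survivingWeight t w θ S i =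
            ((1 - θ) / ∏ j ∈ touching t i, (1 - θ * w j)) * w i * survivingWeight t w θ S i := by
          intro S
          simp only [survivingWeight]
          split_ifs <;> ring
        simp only [hsq]
        rw [subsetExp_const_mul, subsetExp_survivingWeight hx0]
        have ha : (1 - θ) / ∏ j ∈ touching t i, (1 - θ * w j) ≤ 2 := by
          rw [div_le_iff₀ (hx0 i)]
          linarith [hx i]
        have ha0 : 0 ≤ (1 - θ) / ∏ j ∈ touching t i, (1 - θ * w j) :=
          div_nonneg (by linarith) (hx0 i).le
        have hb : (1 - θ) * w i ≤ w i := by nlinarith [hw.1 i]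
        have hb0 : 0 ≤ (1 - θ) * w i := mul_nonneg (by linarith) (hw.1 i)
        have hr : 0 ≤ (1 - θ) ^ 2 / (s * (1 - 4 * c)) * (w i * w i) :=
          mul_nonneg (div_nonneg (sq_nonneg _) (mul_nonneg hs0.le (by linarith)))
            (mul_self_nonneg _)
        have : (1 - θ) / (∏ j ∈ touching t i, (1 - θ * w j)) * w i * ((1 - θ) * w i)
            ≤ 2 * c * w i :=
          mul_le_mul (mul_le_mul ha (hc i) (hw.1 i) zero_le_two) hb hb0 (by linarith)
        linarith
      · rw [add_zero]
        exact subsetExp_survivingWeight_mul_le ht hw hc hc8 hθ hθ1 hi hj hij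
    refine (sum_le_sum fun i hi => sum_le_sum fun j hj => hterm i hi j hj).trans ?_
    simp only [sum_add_distrib, ← mul_sum, sum_ite_eq]
    rw [← sum_mul, ← sq]
    refine add_le_add le_rfl ?_
    calc _ = ∑ i with e ∈ t i, 2 * c * w i := sum_congr rfl fun i hi => if_pos hi
      _ = 2 * c * D := by rw [← mul_sum, hD, load]
      _ ≤ 2 * c := by nlinarith
  have hpoint : ∀ S : Finset ι, max (load t (survivingWeight t w θ S) e - 1) 0 ≤
      1 / η * (load t (survivingWeight t w θ S) e * load t (survivingWeight t w θ S) e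
        - 2 * μ * load t (survivingWeight t w θ S) e
        + μ ^ 2 * if Disjoint S ({k | e ∈ t k} : Finset ι) then 1 else 0) + η := by
    intro S
    by_cases hS : Disjoint S ({k | e ∈ t k} : Finset ι)
    · rw [if_pos hS]
      set L := load t (survivingWeight t w θ S) e
      have h2 : L * L - 2 * μ * L + μ ^ 2 * 1 = (L - μ) ^ 2 := by ring
      rw [h2]
      have h3 : 0 ≤ 1 / η * (L - μ) ^ 2 := by positivity
      refine max_le ?_ (by linarith)
      have h4 : (L - μ) * η ≤ (L - μ) ^ 2 + η * η := by
        nlinarith [sq_nonneg (L - μ - η), sq_nonneg (L - μ), sq_nonneg η]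
      have h5 : L - μ ≤ 1 / η * (L - μ) ^ 2 + η := by
        have : 1 / η * (L - μ) ^ 2 + η = ((L - μ) ^ 2 + η * η) / η := by field_simp
        rw [this, le_div_iff₀ hη]
        exact h4
      linarith
    · have hL : load t (survivingWeight t w θ S) e = 0 := by
        refine sum_eq_zero fun i hi => ?_
        have : ¬ Disjoint S (touching t i) := fun h =>
          hS (disjoint_of_subset_right (through_subset_touching (mem_filter.1 hi).2) h)
        simp [survivingWeight, this]
      simp [hL, hS, hη.le]
  refine (subsetExp_mono hp0 hp1 hpoint).trans ?_
  rw [subsetExp_add, subsetExp_const, subsetExp_const_mul, subsetExp_add, subsetExp_sub,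
    subsetExp_const_mul, subsetExp_const_mul, subsetExp_disjoint, hfirst, ← hsdef]
  have hvar : subsetExp (fun j => θ * w j)
      (fun S => load t (survivingWeight t w θ S) e * load t (survivingWeight t w θ S) e)
      - 2 * μ * ((1 - θ) * D) + μ ^ 2 * s ≤ 10 * c := by
    have h2 : 2 * μ * ((1 - θ) * D) - μ ^ 2 * s = (1 - θ) ^ 2 * D ^ 2 / s := by
      rw [hμ]
      field_simp
      ring
    have h4 : 0 < 1 - 4 * c := by linarith
    have h3 : (1 - θ) ^ 2 / (s * (1 - 4 * c)) * D ^ 2 - (1 - θ) ^ 2 * D ^ 2 / s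
        = μ * ((1 - θ) * D) * (4 * c / (1 - 4 * c)) := by
      rw [hμ]
      field_simp
      ring
    have h5 : 4 * c / (1 - 4 * c) ≤ 8 * c := by
      rw [div_le_iff₀ h4]
      nlinarith
    have h6 : 0 ≤ 4 * c / (1 - 4 * c) := div_nonneg (by linarith) h4.le
    have h7 : 0 ≤ (1 - θ) * D := mul_nonneg (by linarith) hD0
    have h8 : μ * ((1 - θ) * D) ≤ 1 := by nlinarith
    have h9 : μ * ((1 - θ) * D) * (4 * c / (1 - 4 * c)) ≤ 1 * (8 * c) :=
      mul_le_mul h8 h5 h6 zero_le_one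
    linarith
  have := mul_le_mul_of_nonneg_left hvar (one_div_pos.2 hη).le
  calc _ ≤ 1 / η * (10 * c) + η := add_le_add this le_rfl
    _ = _ := by ring

end Step

omit [DecidableEq ι] in
lemma IsFracMatching.sum_le_card {t : ι → Finset E} (ht : IsLinearTriple t) {w : ι → ℝ}
    (hw : IsFracMatching t w) : ∑ i, w i ≤ Fintype.card E := by
  have h1 := sum_mul_load t w fun _ => 1
  simp only [one_mul, sum_const, ht.1, nsmul_eq_mul, mul_one, ← sum_mul] at h1
  have h2 : ∑ e, load t w e ≤ ∑ e : E, 1 := sum_le_sum fun e _ => hw.2 e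
  have h3 : 0 ≤ ∑ i, w i := sum_nonneg fun i _ => hw.1 i
  simp only [sum_const, card_univ, nsmul_eq_mul, mul_one] at h2
  push_cast at h1
  linarith

/-- One bite of the nibble. -/
lemma exists_nibble_step {t : ι → Finset E} (ht : IsLinearTriple t) {w : ι → ℝ}
    (hw : IsFracMatching t w) {c θ η a : ℝ} (hc : ∀ i, w i ≤ c) (hc0 : 0 ≤ c) (hc8 : c ≤ 1 / 8)
    (hθ : 0 ≤ θ) (hθ1 : θ ≤ 1 / 6) (hη : 0 < η) (ha : 0 ≤ a) (ha1 : a ≤ 1) :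
    ∃ (M : Finset ι) (v : ι → ℝ), (M : Set ι).PairwiseDisjoint t ∧ (∀ i ∈ M, w i ≠ 0) ∧
      IsFracMatching t v ∧ (∀ i, v i ≤ 2 * c) ∧
      (∀ i, v i ≠ 0 → w i ≠ 0 ∧ ∀ j ∈ M, Disjoint (t j) (t i)) ∧
      (1 - (a * (1 - θ) + 3 * θ ^ 2)) * ∑ i, w i - (10 * c / η + η) * Fintype.card E
        ≤ #M + (1 - a) * ∑ i, v i := by
  have h1 : ∀ i, w i ≤ 1 := fun i => (hc i).trans (by linarith)
  have hx : ∀ i, 1 / 2 ≤ ∏ j ∈ touching t i, (1 - θ * w j) := fun i =>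
    le_trans (by linarith) (one_sub_le_prod_touching ht hw h1 hθ (by linarith) i)
  have hx0 : ∀ i, 0 < ∏ j ∈ touching t i, (1 - θ * w j) := fun i =>
    lt_of_lt_of_le (by norm_num) (hx i)
  have hp0 : ∀ k, 0 ≤ θ * w k := fun k => mul_nonneg hθ (hw.1 k)
  have hp1 : ∀ k, θ * w k ≤ 1 := fun k => mul_le_one₀ (by linarith) (hw.1 k) (h1 k)
  let M : Finset ι → Finset ι := fun S =>
    {i | w i ≠ 0 ∧ i ∈ S ∧ Disjoint S ((touching t i).erase i)}
  have hM : θ * (1 - 3 * θ) * ∑ i, w i ≤ subsetExp (fun j => θ * w j) (fun S => (#(M S) : ℝ)) := by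
    have hcard : ∀ S, (#(M S) : ℝ) = ∑ i with w i ≠ 0,
        if i ∈ S ∧ Disjoint S ((touching t i).erase i) then 1 else 0 := by
      intro S
      rw [← sum_filter, filter_filter, sum_const, nsmul_eq_mul, mul_one]
    simp only [hcard]
    rw [subsetExp_sum, mul_sum, ← sum_filter_ne_zero]
    refine le_trans (sum_le_sum_of_subset_of_nonneg (fun i hi => ?_) fun i hi _ => ?_)
      (sum_le_sum (f := fun i => θ * (1 - 3 * θ) * w i) fun i _ => ?_)
    · simp only [mem_filter, mem_univ, true_and] at hi ⊢
      exact right_ne_zero_of_mul hi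
    · exact mul_nonneg (mul_nonneg hθ (by linarith)) (hw.1 i)
    · rw [subsetExp_mem_disjoint _ (notMem_erase _ _)]
      have h2 : ∏ j ∈ touching t i, (1 - θ * w j)
          ≤ ∏ j ∈ (touching t i).erase i, (1 - θ * w j) := by
        rw [← prod_sdiff (erase_subset i (touching t i))]
        refine mul_le_of_le_one_left (prod_nonneg fun j _ => sub_nonneg.2 (hp1 j)) ?_
        exact prod_le_one (fun j _ => sub_nonneg.2 (hp1 j)) fun j _ => by linarith [hp0 j]
      have h3 := (one_sub_le_prod_touching ht hw h1 hθ (by linarith) i).trans h2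
      calc θ * (1 - 3 * θ) * w i = θ * w i * (1 - 3 * θ) := by ring
        _ ≤ _ := mul_le_mul_of_nonneg_left h3 (hp0 i)
  have hweight : (1 - θ) * ∑ i, w i - (10 * c / η + η) * Fintype.card E ≤
      subsetExp (fun j => θ * w j) (fun S => ∑ i, survivingWeight t w θ S i
        - ∑ e, max (load t (survivingWeight t w θ S) e - 1) 0) := by
    rw [subsetExp_sub, subsetExp_sum, subsetExp_sum]
    simp only [subsetExp_survivingWeight hx0]
    rw [← mul_sum]
    refine sub_le_sub_left ?_ _
    refine (sum_le_sum fun e _ => subsetExp_excess_le ht hw hc hc0 hc8 hθ hθ1 hη e).trans ?_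
    rw [sum_const, card_univ, nsmul_eq_mul, mul_comm]
  obtain ⟨S, hS⟩ := exists_le_of_le_subsetExp hp0 hp1 (F := fun S => (#(M S) : ℝ) + (1 - a) *
      (∑ i, survivingWeight t w θ S i - ∑ e, max (load t (survivingWeight t w θ S) e - 1) 0))
    (c := (1 - (a * (1 - θ) + 3 * θ ^ 2)) * ∑ i, w i - (10 * c / η + η) * Fintype.card E) (by
      rw [subsetExp_add, subsetExp_const_mul]
      have h2 := mul_le_mul_of_nonneg_left hweight (sub_nonneg.2 ha1)
      have h3 : 0 ≤ (10 * c / η + η) * Fintype.card E := by positivity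
      nlinarith [mul_nonneg ha h3])
  have hv0 : ∀ i, 0 ≤ survivingWeight t w θ S i := fun i => by
    unfold survivingWeight
    have : 0 ≤ (1 - θ) / (∏ j ∈ touching t i, (1 - θ * w j)) * w i :=
      mul_nonneg (div_nonneg (by linarith) (hx0 i).le) (hw.1 i)
    split_ifs <;> simp [this]
  obtain ⟨v, hv, hvle, hvsum⟩ := exists_isFracMatching_le t hv0
  refine ⟨M S, v, ?_, ?_, hv, ?_, ?_, ?_⟩
  · intro i hi j hj hij
    simp only [M, coe_filter, mem_univ, true_and, Set.mem_ofPred_eq] at hi hj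
    by_contra hd
    refine disjoint_left.1 hi.2.2 hj.2.1 (mem_erase.2 ⟨hij.symm, ?_⟩)
    simpa [touching, disjoint_comm] using hd
  · intro i hi
    exact (mem_filter.1 hi).2.1
  · intro i
    refine (hvle i).trans ?_
    have h2 : (1 - θ) / (∏ j ∈ touching t i, (1 - θ * w j)) ≤ 2 := by
      rw [div_le_iff₀ (hx0 i)]
      linarith [hx i]
    have h3 := mul_le_mul h2 (hc i) (hw.1 i) zero_le_two
    unfold survivingWeight
    split_ifs
    · rwa [mul_one]
    · rw [mul_zero]; positivity
  · intro i hi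
    have h2 : survivingWeight t w θ S i ≠ 0 := fun h => hi (le_antisymm (h ▸ hvle i) (hv.1 i))
    unfold survivingWeight at h2
    refine ⟨right_ne_zero_of_mul (left_ne_zero_of_mul h2), fun j hj => ?_⟩
    have h3 : Disjoint S (touching t i) := by
      by_contra h
      simp [h] at h2
    have := disjoint_left.1 h3 (mem_filter.1 hj).2.2.1
    simpa [touching] using this
  · refine hS.trans (add_le_add le_rfl (mul_le_mul_of_nonneg_left hvsum (sub_nonneg.2 ha1)))

/-- Fractional matchings with small weights can be rounded to matchings, up to a multiplicative
loss `a` and an additive loss. -/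
def RoundingLoss (a : ℝ) : Prop :=
  ∀ b : ℝ, 0 < b → ∃ c : ℝ, 0 < c ∧ ∀ (E ι : Type) [Fintype E] [DecidableEq E] [Fintype ι]
    [DecidableEq ι] (t : ι → Finset E), IsLinearTriple t → ∀ w : ι → ℝ, IsFracMatching t w →
    (∀ i, w i ≤ c) → ∃ M : Finset ι, (M : Set ι).PairwiseDisjoint t ∧ (∀ i ∈ M, w i ≠ 0) ∧
      (1 - a) * ∑ i, w i - b * Fintype.card E ≤ #M

lemma roundingLoss_one : RoundingLoss 1 := fun b hb =>
  ⟨1, one_pos, fun E ι _ _ _ _ t _ w _ _ => ⟨∅, by simp, by simp, by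
    simp only [sub_self, zero_mul, zero_sub, card_empty, Nat.cast_zero, neg_nonpos]
    positivity⟩⟩

lemma RoundingLoss.step {a θ : ℝ} (h : RoundingLoss a) (ha : 0 ≤ a) (ha1 : a ≤ 1) (hθ : 0 ≤ θ)
    (hθ1 : θ ≤ 1 / 6) : RoundingLoss (a * (1 - θ) + 3 * θ ^ 2) := by
  intro b hb
  obtain ⟨c', hc', h⟩ := h (b / 2) (by positivity)
  refine ⟨min (1 / 8) (min (c' / 2) ((b / 4) * (b / 40))), by positivity, ?_⟩
  intro E ι _ _ _ _ t ht w hw hc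
  set c := min (1 / 8) (min (c' / 2) ((b / 4) * (b / 40))) with hcdef
  have hc8 : c ≤ 1 / 8 := min_le_left _ _
  have hcc' : 2 * c ≤ c' := by
    have : c ≤ c' / 2 := (min_le_right _ _).trans (min_le_left _ _)
    linarith
  have hcb : c ≤ (b / 4) * (b / 40) := (min_le_right _ _).trans (min_le_right _ _)
  have hc0 : 0 < c := by positivity
  obtain ⟨M, v, hM, hMw, hv, hv2, hvM, hsum⟩ :=
    exists_nibble_step ht hw hc hc0.le hc8 hθ hθ1 (η := b / 4) (by positivity) ha ha1
  obtain ⟨M', hM', hMv, hsum'⟩ := h E ι t ht v hv fun i => (hv2 i).trans hcc'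
  have hcross : ∀ i ∈ M, ∀ j ∈ M', Disjoint (t i) (t j) := fun i hi j hj =>
    (hvM j (hMv j hj)).2 i hi
  have hdisj : Disjoint M M' := by
    refine disjoint_left.2 fun i hi hi' => ?_
    have h0 := disjoint_self.1 (hcross i hi i hi')
    have h3 := ht.1 i
    simp [h0] at h3
  refine ⟨M ∪ M', ?_, ?_, ?_⟩
  · rw [coe_union]
    exact (Set.pairwiseDisjoint_union).2 ⟨hM, hM', fun i hi j hj _ => hcross i hi j hj⟩
  · intro i hi
    rcases mem_union.1 hi with hi | hi
    · exact hMw i hi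
    · exact (hvM i (hMv i hi)).1
  · rw [card_union_of_disjoint hdisj]
    push_cast
    have h1 : 10 * c / (b / 4) ≤ b / 4 := by
      rw [div_le_iff₀ (by positivity)]
      linarith
    have h2 : (10 * c / (b / 4) + b / 4) * Fintype.card E ≤ b / 2 * Fintype.card E := by
      gcongr
      linarith
    linarith

lemma RoundingLoss.mono {a a' : ℝ} (h : RoundingLoss a) (haa' : a ≤ a') : RoundingLoss a' := by
  intro b hb
  obtain ⟨c, hc, h⟩ := h b hb
  refine ⟨c, hc, fun E ι _ _ _ _ t ht w hw hwc => ?_⟩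
  obtain ⟨M, hM, hMw, hsum⟩ := h E ι t ht w hw hwc
  refine ⟨M, hM, hMw, le_trans ?_ hsum⟩
  have : 0 ≤ ∑ i, w i := sum_nonneg fun i _ => hw.1 i
  nlinarith

lemma roundingLoss_of_pos {a : ℝ} (ha : 0 < a) : RoundingLoss a := by
  set θ := min (1 / 6) (a / 6) with hθ
  have hθ0 : 0 < θ := by positivity
  have hθ1 : θ ≤ 1 / 6 := min_le_left _ _
  have hθa : θ ≤ a / 6 := min_le_right _ _
  have hiter : ∀ k : ℕ, RoundingLoss ((1 - 3 * θ) * (1 - θ) ^ k + 3 * θ) := by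
    intro k
    induction k with
    | zero => simpa using roundingLoss_one
    | succ k ih =>
      have hp0 : 0 ≤ (1 - θ) ^ k := pow_nonneg (by linarith) k
      have hp1 : (1 - θ) ^ k ≤ 1 := pow_le_one₀ (by linarith) (by linarith)
      convert ih.step (θ := θ) (by nlinarith) (by nlinarith) hθ0.le hθ1 using 1
      ring
  obtain ⟨k, hk⟩ := exists_pow_lt_of_lt_one (show 0 < a / 2 by positivity)
    (show 1 - θ < 1 by linarith)
  refine (hiter k).mono ?_
  have hp0 : 0 ≤ (1 - θ) ^ k := pow_nonneg (by linarith) k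
  nlinarith

/-- A fractional matching of a 3-uniform linear hypergraph all of whose weights are small can be
rounded to a matching of almost the same size. -/
theorem exists_matching_of_isFracMatching {b : ℝ} (hb : 0 < b) :
    ∃ c : ℝ, 0 < c ∧ ∀ (E ι : Type) [Fintype E] [DecidableEq E] [Fintype ι]
      [DecidableEq ι] (t : ι → Finset E), IsLinearTriple t → ∀ w : ι → ℝ, IsFracMatching t w →
      (∀ i, w i ≤ c) → ∃ M : Finset ι, (M : Set ι).PairwiseDisjoint t ∧
        ∑ i, w i - b * Fintype.card E ≤ #M := by
  obtain ⟨c, hc, h⟩ := roundingLoss_of_pos (half_pos hb) (b / 2) (half_pos hb)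
  refine ⟨c, hc, fun E ι _ _ _ _ t ht w hw hwc => ?_⟩
  obtain ⟨M, hM, -, hsum⟩ := h E ι t ht w hw hwc
  refine ⟨M, hM, le_trans ?_ hsum⟩
  have hle := hw.sum_le_card ht
  nlinarith

end Nibble

section CappedDuality

variable {E ι : Type*} [Fintype E] [DecidableEq E] [Fintype ι] [DecidableEq ι]

/-- An approximate form of linear programming duality for fractional matchings with weights
bounded by `c`. -/
theorem exists_isFracMatching_le_and_cover (t : ι → Finset E) {c K : ℝ} (hc : 0 ≤ c)
    (hK : 0 < K) :
    ∃ (v : ι → ℝ) (y : E → ℝ), IsFracMatching t v ∧ (∀ i, v i ≤ c) ∧ (∀ e, 0 ≤ y e) ∧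
      (∀ e, y e ≤ 1) ∧
      ∑ e, y e + c * ∑ i, max (1 - ∑ e ∈ t i, y e) 0 ≤ (1 + 1 / K) * ∑ i, v i := by
  let m : (ι → ℝ) → E → ℝ := fun w e => max (load t w e - 1) 0
  let F : (ι → ℝ) → ℝ := fun w => ∑ i, w i - K / 2 * ∑ e, m w e ^ 2
  have hF : Continuous F := by
    simp only [F, m, load]
    fun_prop
  obtain ⟨w, hw, hmax⟩ := (isCompact_Icc (a := (0 : ι → ℝ)) (b := fun _ => c)).exists_isMaxOn
    ⟨0, le_rfl, fun _ => hc⟩ hF.continuousOn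
  have hw0 : ∀ i, 0 ≤ w i := hw.1
  have hwc : ∀ i, w i ≤ c := hw.2
  have hm0 : ∀ e, 0 ≤ m w e := fun e => le_max_right _ _
  set y : E → ℝ := fun e => K * m w e with hy
  have hy0 : ∀ e, 0 ≤ y e := fun e => mul_nonneg hK.le (hm0 e)
  have hmove : ∀ i s, 0 ≤ w i + s → w i + s ≤ c →
      s * (1 - ∑ e ∈ t i, y e) ≤ K / 2 * (#(t i) * s ^ 2) := by
    intro i s h0 h1
    set u : ι → ℝ := fun j => w j + if j = i then s else 0 with hu
    have hmem : u ∈ Set.Icc (0 : ι → ℝ) (fun _ => c) := by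
      constructor <;> intro j <;> simp only [hu] <;> split_ifs with hj
      · subst hj; exact h0
      · simpa using hw0 j
      · subst hj; exact h1
      · simpa using hwc j
    have hload : ∀ e, load t u e = load t w e + if e ∈ t i then s else 0 := by
      intro e
      simp only [load, hu, sum_add_distrib, sum_ite_eq', mem_filter, mem_univ, true_and]
    have hsq : ∀ e, m u e ^ 2 ≤ m w e ^ 2 + if e ∈ t i then 2 * s * m w e + s ^ 2 else 0 := by
      intro e
      simp only [m, hload]
      split_ifs with he
      · rcases le_total (load t w e) 1 with h | h
        · rw [max_eq_right (by linarith : load t w e - 1 ≤ 0)]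
          rcases le_total (load t w e + s - 1) 0 with h' | h'
          · rw [max_eq_right h']; nlinarith
          · rw [max_eq_left h']; nlinarith
        · rw [max_eq_left (by linarith : 0 ≤ load t w e - 1)]
          rcases le_total (load t w e + s - 1) 0 with h' | h'
          · rw [max_eq_right h']; nlinarith [sq_nonneg (load t w e - 1 + s)]
          · rw [max_eq_left h']; nlinarith
      · simp
    have hsum : ∑ e, m u e ^ 2 ≤ ∑ e, m w e ^ 2 + (2 * s * ∑ e ∈ t i, m w e + #(t i) * s ^ 2) := by
      refine (sum_le_sum fun e _ => hsq e).trans_eq ?_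
      rw [sum_add_distrib, sum_ite_mem, univ_inter, sum_add_distrib, ← mul_sum, sum_const,
        nsmul_eq_mul]
    have hle : F u ≤ F w := hmax hmem
    have hsu : ∑ j, u j = ∑ j, w j + s := by
      simp [hu, sum_add_distrib]
    simp only [F, hsu] at hle
    have hsum' := mul_le_mul_of_nonneg_left hsum (half_pos hK).le
    simp only [hy, ← mul_sum]
    nlinarith
  have hslack : ∀ i, w i * (1 - ∑ e ∈ t i, y e) = c * max (1 - ∑ e ∈ t i, y e) 0 := by
    intro i
    have hk : 0 < K * (#(t i) + 1) := by positivity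
    rcases lt_trichotomy (1 - ∑ e ∈ t i, y e) 0 with hr | hr | hr
    · rw [max_eq_right hr.le]
      have : w i = 0 := by
        by_contra hne
        have hpos : 0 < w i := lt_of_le_of_ne (hw0 i) (Ne.symm hne)
        set s := min (w i) (-(1 - ∑ e ∈ t i, y e) / (K * (#(t i) + 1))) with hs
        have hs0 : 0 < s := lt_min hpos (div_pos (by linarith) hk)
        have hs1 : s * (K * (#(t i) + 1)) ≤ -(1 - ∑ e ∈ t i, y e) :=
          (le_div_iff₀ hk).1 (min_le_right _ _)
        have hs2 : s ≤ w i := min_le_left _ _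
        have := hmove i (-s) (by linarith) (by linarith [hwc i])
        have h3 := mul_le_mul_of_nonneg_left hs1 hs0.le
        nlinarith [mul_pos hK (mul_pos hs0 hs0), mul_nonneg (Nat.cast_nonneg (α := ℝ) #(t i))
          (mul_pos hK (mul_pos hs0 hs0)).le]
      rw [this]; ring
    · rw [hr]; simp
    · rw [max_eq_left hr.le]
      have : w i = c := by
        by_contra hne
        have hpos : 0 < c - w i := sub_pos.2 (lt_of_le_of_ne (hwc i) hne)
        set s := min (c - w i) ((1 - ∑ e ∈ t i, y e) / (K * (#(t i) + 1))) with hs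
        have hs0 : 0 < s := lt_min hpos (div_pos hr hk)
        have hs1 : s * (K * (#(t i) + 1)) ≤ 1 - ∑ e ∈ t i, y e :=
          (le_div_iff₀ hk).1 (min_le_right _ _)
        have hs2 : s ≤ c - w i := min_le_left _ _
        have := hmove i s (by linarith [hw0 i]) (by linarith)
        have h3 := mul_le_mul_of_nonneg_left hs1 hs0.le
        nlinarith [mul_pos hK (mul_pos hs0 hs0), mul_nonneg (Nat.cast_nonneg (α := ℝ) #(t i))
          (mul_pos hK (mul_pos hs0 hs0)).le]
      rw [this]
  have hy1 : ∀ e, y e ≤ 1 := by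
    intro e
    by_contra! he
    have hz : load t w e = 0 := by
      refine sum_eq_zero fun i hi => ?_
      have h1 := single_le_sum (f := y) (fun e _ => hy0 e) (mem_filter.1 hi).2
      have h2 := hslack i
      rw [max_eq_right (by linarith), mul_zero] at h2
      exact (mul_eq_zero.1 h2).resolve_right (by linarith)
    simp only [hy, m, hz] at he
    norm_num at he
  have hK1 : 0 < 1 + 1 / K := by positivity
  have hload : ∀ e, load t w e ≤ 1 + 1 / K := by
    intro e
    have h1 : K * (load t w e - 1) ≤ 1 :=
      (mul_le_mul_of_nonneg_left (le_max_left _ _) hK.le).trans (hy1 e)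
    have h2 : load t w e - 1 ≤ 1 / K := by rwa [le_div_iff₀' hK]
    linarith
  refine ⟨fun i => (1 + 1 / K)⁻¹ * w i, y, ⟨fun i => mul_nonneg (inv_nonneg.2 hK1.le) (hw0 i),
    fun e => ?_⟩, fun i => ?_, hy0, hy1, ?_⟩
  · rw [load_const_mul, inv_mul_le_iff₀ hK1, mul_one]
    exact hload e
  · refine (mul_le_of_le_one_left (hw0 i) (inv_le_one_of_one_le₀ ?_)).trans (hwc i)
    have := one_div_pos.2 hK
    linarith
  · rw [← mul_sum univ w, mul_inv_cancel_left₀ hK1.ne', mul_sum univ (fun i => max _ _),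
      ← sum_congr rfl fun i _ => hslack i]
    have h1 : ∑ e, y e ≤ ∑ e, y e * load t w e := by
      refine sum_le_sum fun e _ => ?_
      rcases le_total (load t w e) 1 with h | h
      · have : y e = 0 := by simp only [hy, m, max_eq_right (sub_nonpos.2 h), mul_zero]
        simp [this]
      · exact le_mul_of_one_le_right (hy0 e) h
    rw [sum_mul_load] at h1
    simp only [mul_sub, mul_one, sum_sub_distrib]
    linarith

end CappedDuality

section Triangles

variable {V : Type*} [DecidableEq V]

/-- The pairs of distinct vertices in a set of vertices. -/
def innerPairs (T : Finset V) : Finset (Sym2 V) := T.offDiag.image fun q => s(q.1, q.2)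

lemma mk_mem_innerPairs {T : Finset V} {u v : V} :
    s(u, v) ∈ innerPairs T ↔ u ∈ T ∧ v ∈ T ∧ u ≠ v := by
  simp only [innerPairs, mem_image, mem_offDiag, Prod.exists, Sym2.eq_iff]
  constructor
  · rintro ⟨a, b, ⟨ha, hb, hab⟩, ⟨rfl, rfl⟩ | ⟨rfl, rfl⟩⟩
    · exact ⟨ha, hb, hab⟩
    · exact ⟨hb, ha, hab.symm⟩
  · rintro ⟨hu, hv, huv⟩
    exact ⟨u, v, ⟨hu, hv, huv⟩, Or.inl ⟨rfl, rfl⟩⟩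

lemma innerPairs_triple {x y z : V} (hxy : x ≠ y) (hxz : x ≠ z) (hyz : y ≠ z) :
    innerPairs {x, y, z} = {s(x, y), s(x, z), s(y, z)} := by
  ext e
  induction e with | _ u v
  simp only [mk_mem_innerPairs, mem_insert, mem_singleton, Sym2.eq_iff]
  grind

lemma sum_innerPairs_triple {M : Type*} [AddCommMonoid M] (f : Sym2 V → M) {x y z : V}
    (hxy : x ≠ y) (hxz : x ≠ z) (hyz : y ≠ z) :
    ∑ e ∈ innerPairs {x, y, z}, f e = f s(x, y) + (f s(x, z) + f s(y, z)) := by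
  rw [innerPairs_triple hxy hxz hyz, sum_insert, sum_pair]
  · simp only [ne_eq, Sym2.eq_iff]; grind
  · simp only [mem_insert, mem_singleton, Sym2.eq_iff]; grind

/-- The auxiliary graph whose triangles are the triangles of `G` with prescribed values of `f` on
their edges. A vertex `(x, i, τ)` carries its position `i` in the triangle and the values `τ`, where
`τ k` is the value on the edge opposite to position `k`. -/
def patternGraph (G : SimpleGraph V) (f : Sym2 V → ℕ) (L : ℕ) :
    SimpleGraph (V × Fin 3 × (Fin 3 → Fin (L + 1))) where
  Adj a b := G.Adj a.1 b.1 ∧ a.2.1 ≠ b.2.1 ∧ a.2.2 = b.2.2 ∧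
    f s(a.1, b.1) = a.2.2 (-(a.2.1 + b.2.1)) ∧ ∑ k, (a.2.2 k : ℕ) + 4 ≤ L
  symm := ⟨by
    rintro a b ⟨h1, h2, h3, h4, h5⟩
    refine ⟨h1.symm, h2.symm, h3.symm, ?_, h3 ▸ h5⟩
    rw [Sym2.eq_swap, h4, h3, add_comm a.2.1]⟩
  loopless := ⟨fun a h => h.2.1 rfl⟩

lemma sum_opposite {i j k : Fin 3} (hij : i ≠ j) (hik : i ≠ k) (hjk : j ≠ k) (g : Fin 3 → ℕ) :
    g (-(i + j)) + (g (-(i + k)) + g (-(j + k))) = ∑ l, g l := by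
  have h1 : (-1 : Fin 3) = 2 := rfl
  have h2 : (-2 : Fin 3) = 1 := rfl
  rw [Fin.sum_univ_three]
  fin_cases i <;> fin_cases j <;> fin_cases k <;> simp_all <;> ring

lemma patternGraph_triangle {G : SimpleGraph V} {f : Sym2 V → ℕ} {L : ℕ}
    {a b c : V × Fin 3 × (Fin 3 → Fin (L + 1))} (hab : (patternGraph G f L).Adj a b)
    (hac : (patternGraph G f L).Adj a c) (hbc : (patternGraph G f L).Adj b c) :
    ∑ e ∈ innerPairs {a.1, b.1, c.1}, f e + 4 ≤ L := by
  rw [sum_innerPairs_triple f hab.1.ne hac.1.ne hbc.1.ne, hab.2.2.2.1, hac.2.2.2.1, hbc.2.2.2.1,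
    ← hab.2.2.1, sum_opposite hab.2.1 hac.2.1 hbc.2.1 fun k => (a.2.2 k : ℕ)]
  exact hab.2.2.2.2

end Triangles

open Classical in
/-- If a weighting of the pairs of vertices gives few triangles a total weight below `1 - 1 / L`,
then after removing few edges all triangles have total weight at least `1 - 4 / L`. -/
theorem exists_removal_of_card_light_triangles_lt {L : ℕ} (hL : 0 < L) {ε : ℝ} (hε : 0 < ε) :
    ∃ δ : ℝ, 0 < δ ∧ ∀ (V : Type) [Fintype V] (G : SimpleGraph V)
      (y : Sym2 V → ℝ), (∀ e, 0 ≤ y e) → (∀ e, y e ≤ 1) →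
      (#{T ∈ G.cliqueFinset 3 | ∑ e ∈ innerPairs T, y e < 1 - 1 / L} : ℝ)
        < δ * (Fintype.card V : ℝ) ^ 3 →
      ∃ R : Finset (Sym2 V), #R ≤ ε * (Fintype.card V : ℝ) ^ 2 ∧
        ∀ T ∈ G.cliqueFinset 3, Disjoint (innerPairs T) R → 1 - 4 / L ≤ ∑ e ∈ innerPairs T, y e := by
  let Q := Fin 3 × (Fin 3 → Fin (L + 1))
  set q : ℕ := Fintype.card Q with hq
  have hq0 : 0 < q := Fintype.card_pos
  set κ := SimpleGraph.triangleRemovalBound (ε / q ^ 2) with hκ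
  have hκ0 : 0 < κ := SimpleGraph.triangleRemovalBound_pos (by positivity)
  refine ⟨κ * q ^ 3 / 2 ^ (3 * q), by positivity, ?_⟩
  intro V _ G y hy0 hy1 hlight
  have hL0 : (0 : ℝ) < L := by exact_mod_cast hL
  let f : Sym2 V → ℕ := fun e => ⌊L * y e⌋₊
  have hf_le : ∀ e, (f e : ℝ) ≤ L * y e := fun e => Nat.floor_le (mul_nonneg hL0.le (hy0 e))
  have hf_lt : ∀ e, L * y e < f e + 1 := fun e => Nat.lt_floor_add_one _
  have hfL : ∀ e, f e < L + 1 := by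
    intro e
    have : (f e : ℝ) ≤ L := (hf_le e).trans (mul_le_of_le_one_right hL0.le (hy1 e))
    exact Nat.lt_succ_of_le (by exact_mod_cast this)
  let H := patternGraph G f L
  have hcardW : Fintype.card (V × Q) = Fintype.card V * q := Fintype.card_prod _ _
  have hlightOf : ∀ x u v : V, x ≠ u → x ≠ v → u ≠ v → ∑ e ∈ innerPairs {x, u, v}, f e + 4 ≤ L →
      ∑ e ∈ innerPairs {x, u, v}, y e < 1 - 1 / L := by
    intro x u v hxu hxv huv h
    rw [sum_innerPairs_triple _ hxu hxv huv] at h ⊢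
    have h' : (f s(x, u) + (f s(x, v) + f s(u, v)) + 4 : ℝ) ≤ L := by exact_mod_cast h
    have : 1 - 1 / (L : ℝ) = (L - 1) / L := by field_simp
    rw [this, lt_div_iff₀' hL0]
    linarith [hf_lt s(x, u), hf_lt s(x, v), hf_lt s(u, v)]
  have hmaps : ∀ S ∈ H.cliqueFinset 3, S.image Prod.fst ∈
      ({T ∈ G.cliqueFinset 3 | ∑ e ∈ innerPairs T, y e < 1 - 1 / L} : Finset (Finset V)) := by
    intro S hS
    obtain ⟨a, b, c, hab, hac, hbc, rfl⟩ :=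
      SimpleGraph.is3Clique_iff.1 (SimpleGraph.mem_cliqueFinset_iff.1 hS)
    simp only [image_insert, image_singleton, mem_filter, SimpleGraph.mem_cliqueFinset_iff]
    exact ⟨SimpleGraph.is3Clique_triple_iff.2 ⟨hab.1, hac.1, hbc.1⟩,
      hlightOf _ _ _ hab.1.ne hac.1.ne hbc.1.ne (patternGraph_triangle hab hac hbc)⟩
  have hfiber : ∀ T ∈ ({T ∈ G.cliqueFinset 3 | ∑ e ∈ innerPairs T, y e < 1 - 1 / L} :
      Finset (Finset V)), #{S ∈ H.cliqueFinset 3 | S.image Prod.fst = T} ≤ 2 ^ (3 * q) := by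
    intro T hT
    have hT3 : #T = 3 := (SimpleGraph.mem_cliqueFinset_iff.1 (mem_filter.1 hT).1).card_eq
    calc _ ≤ #(T ×ˢ (univ : Finset Q)).powerset := by
          refine card_le_card fun S hS => mem_powerset.2 fun a ha => ?_
          rw [mem_product]
          exact ⟨(mem_filter.1 hS).2 ▸ mem_image_of_mem _ ha, mem_univ _⟩
      _ = 2 ^ (3 * q) := by rw [card_powerset, card_product, hT3, card_univ, hq]
  have hcount : (#(H.cliqueFinset 3) : ℝ) < κ * (Fintype.card (V × Q) : ℝ) ^ 3 := by
    have h1 : (#(H.cliqueFinset 3) : ℝ) ≤ 2 ^ (3 * q) *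
        #{T ∈ G.cliqueFinset 3 | ∑ e ∈ innerPairs T, y e < 1 - 1 / L} := by
      exact_mod_cast card_le_mul_card_image_of_maps_to hmaps _ hfiber
    refine h1.trans_lt ((mul_lt_mul_of_pos_left hlight (by positivity)).trans_eq ?_)
    rw [hcardW]
    push_cast
    field_simp
  have hnotfar : ¬ H.FarFromTriangleFree (ε / q ^ 2) := fun h =>
    absurd h.le_card_cliqueFinset (not_le.2 hcount)
  simp only [SimpleGraph.FarFromTriangleFree, SimpleGraph.DeleteFar, not_forall, not_le] at hnotfar
  obtain ⟨s, hs, hfree, hcard⟩ := hnotfar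
  refine ⟨s.image (Sym2.map Prod.fst), ?_, ?_⟩
  · refine le_trans (by exact_mod_cast card_image_le) (hcard.le.trans_eq ?_)
    rw [hcardW]
    push_cast
    field_simp
  · intro T hT hdisj
    obtain ⟨x, u, v, hxu, hxv, huv, rfl⟩ :=
      SimpleGraph.is3Clique_iff.1 (SimpleGraph.mem_cliqueFinset_iff.1 hT)
    by_contra! hlt
    have hsum : ∑ e ∈ innerPairs {x, u, v}, f e + 4 ≤ L := by
      rw [sum_innerPairs_triple _ hxu.ne hxv.ne huv.ne] at hlt ⊢
      have : 1 - 4 / (L : ℝ) = (L - 4) / L := by field_simp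
      rw [this, lt_div_iff₀' hL0] at hlt
      have : (f s(x, u) + (f s(x, v) + f s(u, v)) + 4 : ℝ) < L + 1 := by
        linarith [hf_le s(x, u), hf_le s(x, v), hf_le s(u, v)]
      exact Nat.lt_succ_iff.1 (by exact_mod_cast this)
    rw [sum_innerPairs_triple _ hxu.ne hxv.ne huv.ne] at hsum
    let τ : Fin 3 → Fin (L + 1) :=
      ![⟨f s(u, v), hfL _⟩, ⟨f s(x, v), hfL _⟩, ⟨f s(x, u), hfL _⟩]
    have hτ : ∑ k, (τ k : ℕ) + 4 ≤ L := by
      rw [Fin.sum_univ_three]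
      simp only [τ, Matrix.cons_val]
      omega
    have hkeep : ∀ (a b : V) (i j : Fin 3), a ∈ ({x, u, v} : Finset V) → b ∈ ({x, u, v} : Finset V) →
        G.Adj a b → i ≠ j → f s(a, b) = τ (-(i + j)) →
        (H.deleteEdges (s : Set (Sym2 (V × Q)))).Adj (a, i, τ) (b, j, τ) := by
      intro a b i j ha hb hab hij h
      refine SimpleGraph.deleteEdges_adj.2 ⟨⟨hab, hij, rfl, h, hτ⟩, fun hmem => ?_⟩
      exact disjoint_left.1 hdisj (mk_mem_innerPairs.2 ⟨ha, hb, hab.ne⟩)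
        (mem_image.2 ⟨_, hmem, rfl⟩)
    refine hfree _ (SimpleGraph.is3Clique_triple_iff.2
      ⟨hkeep x u 0 1 (by simp) (by simp) hxu (by decide) rfl,
        hkeep x v 0 2 (by simp) (by simp) hxv (by decide) rfl,
        hkeep u v 1 2 (by simp) (by simp) huv (by decide) rfl⟩)

lemma card_innerPairs_of_card_eq_three {V : Type*} [DecidableEq V] {T : Finset V} (hT : #T = 3) : #(innerPairs T) = 3 := by
  obtain ⟨x, y, z, hxy, hxz, hyz, rfl⟩ := card_eq_three.1 hT
  have := sum_innerPairs_triple (fun _ => 1) hxy hxz hyz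
  simpa using this

lemma isLinearTriple_innerPairs {V : Type*} [Fintype V] [DecidableEq V] (G : SimpleGraph V)
    [DecidableRel G.Adj] :
    IsLinearTriple fun T : G.cliqueFinset 3 => innerPairs T.1 := by
  have h3 (T : G.cliqueFinset 3) : #T.1 = 3 := ((SimpleGraph.mem_cliqueFinset_iff).1 T.2).card_eq
  refine ⟨fun T => card_innerPairs_of_card_eq_three (h3 T), fun T T' hne e he f hf he' hf' => ?_⟩
  have hlt : #(T.1 ∩ T'.1) ≤ 2 := by
    by_contra! h
    have h1 := eq_of_subset_of_card_le (inter_subset_left (s₁ := T.1) (s₂ := T'.1)) (by grind)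
    have h2 := eq_of_subset_of_card_le (inter_subset_right (s₁ := T.1) (s₂ := T'.1)) (by grind)
    exact hne (Subtype.ext (h1.symm.trans h2))
  have key {u v : V} (h : s(u, v) ∈ innerPairs T.1) (h' : s(u, v) ∈ innerPairs T'.1) :
      {u, v} = T.1 ∩ T'.1 := by
    rw [mk_mem_innerPairs] at h h'
    refine eq_of_subset_of_card_le ?_ (by rw [card_pair h.2.2]; exact hlt)
    grind
  induction e with | _ a b
  induction f with | _ a' b'
  have := (key he he').trans (key hf hf').symm
  have hn := (mk_mem_innerPairs.1 he).2.2
  have hn' := (mk_mem_innerPairs.1 hf).2.2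
  rw [Sym2.eq_iff]
  have h1 : a ∈ ({a', b'} : Finset V) := this ▸ by simp
  have h2 : b ∈ ({a', b'} : Finset V) := this ▸ by simp
  grind

lemma card_sym2_le_sq (V : Type*) [Fintype V] :
    (Fintype.card (Sym2 V) : ℝ) ≤ (Fintype.card V : ℝ) ^ 2 := by
  rw [Sym2.card]
  have : (Fintype.card V + 1).choose 2 ≤ Fintype.card V ^ 2 := by
    rw [Nat.choose_two_right]
    refine Nat.div_le_of_le_mul ?_
    simp only [Nat.add_sub_cancel]
    nlinarith [Nat.le_self_pow (two_ne_zero) (Fintype.card V)]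
  exact_mod_cast this

open Classical in
/-- Every fractional triangle packing of a large graph can be rounded to an edge-disjoint triangle
packing with little loss. -/
theorem exists_triangle_packing_of_isFracMatching {ε : ℝ} (hε : 0 < ε) :
    ∃ N : ℕ, ∀ (V : Type) [Fintype V] (G : SimpleGraph V), N ≤ Fintype.card V →
      ∀ w : G.cliqueFinset 3 → ℝ, IsFracMatching (fun T => innerPairs T.1) w →
      ∃ M : Finset (G.cliqueFinset 3), (M : Set (G.cliqueFinset 3)).PairwiseDisjoint
        (fun T => innerPairs T.1) ∧ ∑ T, w T - ε * (Fintype.card V : ℝ) ^ 2 ≤ #M := by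
  obtain ⟨c, hc, hround⟩ := exists_matching_of_isFracMatching (b := ε / 4) (by positivity)
  set L : ℕ := ⌈16 / ε⌉₊ + 1 with hLdef
  have hL : 0 < L := Nat.succ_pos _
  have hL0 : (0 : ℝ) < L := by exact_mod_cast hL
  have hLε : 4 / (L : ℝ) ≤ ε / 4 := by
    have h1 : 16 / ε ≤ L := (Nat.le_ceil _).trans (by rw [hLdef]; push_cast; linarith)
    rw [div_le_iff₀ hε] at h1
    rw [div_le_div_iff₀ hL0 (by norm_num)]
    linarith
  obtain ⟨δ, hδ, hremoval⟩ := exists_removal_of_card_light_triangles_lt hL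
    (ε := ε / 4) (by positivity)
  refine ⟨⌊L * (1 + ε / 4) / (c * δ)⌋₊ + 1, fun V _ G hN w hw => ?_⟩
  set n : ℝ := (Fintype.card V : ℝ) with hn
  have hnN : L * (1 + ε / 4) < c * δ * n := by
    have h1 := Nat.lt_of_floor_lt hN
    rw [div_lt_iff₀ (by positivity)] at h1
    linarith
  have hn0 : 0 < n := by
    by_contra! h
    nlinarith [mul_pos hc hδ]
  have hlin := isLinearTriple_innerPairs G
  have hE := card_sym2_le_sq V
  obtain ⟨v, y, hv, hvc, hy0, hy1, hdual⟩ := exists_isFracMatching_le_and_cover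
    (fun T : G.cliqueFinset 3 => innerPairs T.1) (K := 4 / ε) hc.le (by positivity)
  rw [one_div_div] at hdual
  have hvE : ∑ T, v T ≤ n ^ 2 := (hv.sum_le_card hlin).trans hE
  have hwE : ∑ T, w T ≤ n ^ 2 := (hw.sum_le_card hlin).trans hE
  have hmax0 : 0 ≤ c * ∑ T : G.cliqueFinset 3, max (1 - ∑ e ∈ innerPairs T.1, y e) 0 :=
    mul_nonneg hc.le (sum_nonneg fun _ _ => le_max_right _ _)
  have hlight : (#{T ∈ G.cliqueFinset 3 | ∑ e ∈ innerPairs T, y e < 1 - 1 / (L : ℝ)} : ℝ)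
      < δ * n ^ 3 := by
    have h1 : (#{T ∈ G.cliqueFinset 3 | ∑ e ∈ innerPairs T, y e < 1 - 1 / (L : ℝ)} : ℝ) * (1 / L)
        ≤ ∑ T : G.cliqueFinset 3, max (1 - ∑ e ∈ innerPairs T.1, y e) 0 := by
      rw [sum_coe_sort (G.cliqueFinset 3) fun T => max (1 - ∑ e ∈ innerPairs T, y e) 0,
        ← nsmul_eq_mul, ← sum_const, sum_filter]
      refine sum_le_sum fun T _ => ?_
      split_ifs with h
      · exact le_max_of_le_left (by linarith)
      · exact le_max_right _ _
    have h2 := mul_le_mul_of_nonneg_left h1 hc.le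
    have h3 : 0 ≤ ∑ e, y e := sum_nonneg fun e _ => hy0 e
    have h4 : (1 + ε / 4) * ∑ T, v T ≤ (1 + ε / 4) * n ^ 2 := by gcongr
    rw [mul_one_div, ← mul_div_assoc] at h2
    have h5 := (div_le_iff₀ hL0).1 (h2.trans (by linarith : _ ≤ (1 + ε / 4) * n ^ 2))
    have h6 := mul_lt_mul_of_pos_right hnN (pow_pos hn0 2)
    refine lt_of_mul_lt_mul_left (h5.trans_lt ?_) hc.le
    linarith
  obtain ⟨R, hR, hRcover⟩ := hremoval V G y hy0 hy1 hlight
  obtain ⟨M, hM, hMcard⟩ := hround (Sym2 V) (G.cliqueFinset 3) _ hlin v hv hvc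
  refine ⟨M, hM, ?_⟩
  have hcover : (∑ T, w T) * (1 - 4 / L) ≤ ∑ e, y e + #R := by
    let g : Sym2 V → ℝ := fun e => y e + if e ∈ R then 1 else 0
    have hg0 (e) : 0 ≤ g e := add_nonneg (hy0 e) (by split_ifs <;> norm_num)
    calc (∑ T, w T) * (1 - 4 / L)
        ≤ ∑ T : G.cliqueFinset 3, w T * ∑ e ∈ innerPairs T.1, g e := by
          rw [sum_mul]
          refine sum_le_sum fun T _ => mul_le_mul_of_nonneg_left ?_ (hw.1 T)
          by_cases hd : Disjoint (innerPairs T.1) R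
          · refine (hRcover T.1 T.2 hd).trans (sum_le_sum fun e _ => ?_)
            simp only [g]
            split_ifs <;> linarith
          · obtain ⟨e, he, heR⟩ := not_disjoint_iff.1 hd
            have h1 := single_le_sum (fun e _ => hg0 e) he
            have h2 : 1 ≤ g e := by simp [g, heR, hy0 e]
            have h3 : 0 ≤ 4 / (L : ℝ) := by positivity
            linarith
      _ = ∑ e, g e * load (fun T : G.cliqueFinset 3 => innerPairs T.1) w e :=
          (sum_mul_load _ _ _).symm
      _ ≤ ∑ e, g e := sum_le_sum fun e _ => mul_le_of_le_one_right (hg0 e) (hw.2 e)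
      _ = ∑ e, y e + #R := by simp [g, sum_add_distrib]
  have h1 : (∑ T, w T) * (4 / L) ≤ n ^ 2 * (ε / 4) :=
    mul_le_mul hwE hLε (by positivity) (by positivity)
  have h2 : ε / 4 * ∑ T, v T ≤ ε / 4 * n ^ 2 := by gcongr
  have h3 : ε / 4 * Fintype.card (Sym2 V) ≤ ε / 4 * n ^ 2 := by gcongr
  linarith

lemma piInt_le_sum_card {V κ : Type*} [Fintype κ] {G : SimpleGraph V} {k : ℕ}
    {D : κ → Finset V} (hclique : ∀ i, G.IsClique (D i : Set V)) (hcard2 : ∀ i, 2 ≤ #(D i))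
    (hcard : ∀ i, #(D i) ≤ k) (hcover : ∀ u v, G.Adj u v → ∃! i, u ∈ D i ∧ v ∈ D i) :
    piInt G k ≤ ∑ i, #(D i) := by
  let φ := Fintype.equivFin κ
  refine Nat.sInf_le ⟨Fintype.card κ, D ∘ φ.symm, ⟨fun i => ⟨hclique _, hcard2 _⟩, ?_⟩,
    fun i => hcard _, φ.symm.sum_comp fun i => #(D i)⟩
  intro u v huv
  obtain ⟨i, hi, huniq⟩ := hcover u v huv
  refine ⟨φ i, by simpa using hi, fun j hj => ?_⟩
  rw [← huniq _ hj, φ.apply_symm_apply]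

open Classical in
/-- An edge-disjoint family of triangles, together with the remaining edges, is a decomposition. -/
lemma piInt_add_three_mul_card_le {V : Type*} [Fintype V] {G : SimpleGraph V}
    {M : Finset (G.cliqueFinset 3)}
    (hM : (M : Set (G.cliqueFinset 3)).PairwiseDisjoint fun T => innerPairs T.1) :
    piInt G 3 + 3 * #M ≤ 2 * #G.edgeFinset := by
  have hT (T : G.cliqueFinset 3) : G.IsNClique 3 T.1 := SimpleGraph.mem_cliqueFinset_iff.1 T.2
  set B := M.biUnion fun T => innerPairs T.1 with hB
  let U := G.edgeFinset \ B
  have hcardB : #B = 3 * #M := by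
    rw [hB, card_biUnion fun a ha b hb hab => hM ha hb hab,
      sum_const_nat fun T _ => card_innerPairs_of_card_eq_three (hT T).card_eq, mul_comm]
  have hBsub : B ⊆ G.edgeFinset := by
    refine biUnion_subset.2 fun T _ e he => ?_
    induction e with | _ u v
    rw [mk_mem_innerPairs] at he
    simpa using (hT T).isClique he.1 he.2.1 he.2.2
  have hUcard : #U + #B = #G.edgeFinset := card_sdiff_add_card_eq_card hBsub
  have hUedge (e : U) : e.1 ∈ G.edgeSet := by
    have := (mem_sdiff.1 e.2).1
    simpa using this
  have hcard2 (e : U) : #e.1.toFinset = 2 :=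
    Sym2.card_toFinset_of_not_isDiag _ (G.not_isDiag_of_mem_edgeSet (hUedge e))
  have hle := piInt_le_sum_card (G := G) (k := 3)
    (D := Sum.elim (fun T : M => T.1.1) fun e : U => e.1.toFinset) ?_ ?_ ?_ ?_
  · rw [Fintype.sum_sum_type] at hle
    simp only [Sum.elim_inl, Sum.elim_inr, hcard2, fun T : M => (hT T.1).card_eq, sum_const,
      card_univ, Fintype.card_coe, smul_eq_mul] at hle
    omega
  · rintro (T | e)
    · exact (hT T.1).isClique
    · have he := hUedge e
      obtain ⟨e, heU⟩ := e
      induction e with | _ a b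
      intro u hu v hv huv
      simp only [SimpleGraph.mem_edgeSet] at he
      simp only [Sum.elim_inr, mem_coe, Sym2.mem_toFinset, Sym2.mem_iff] at hu hv
      have := he.symm
      grind
  · rintro (T | e)
    · exact (hT T.1).card_eq.ge.trans' (by norm_num)
    · exact (hcard2 e).ge
  · rintro (T | e)
    · exact (hT T.1).card_eq.le
    · exact (hcard2 e).le.trans (by norm_num)
  · intro u v huv
    have hinr (e : U) (h : u ∈ e.1.toFinset ∧ v ∈ e.1.toFinset) : e.1 = s(u, v) := by
      simp only [Sym2.mem_toFinset] at h
      exact (Sym2.mem_and_mem_iff huv.ne).1 h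
    by_cases he : s(u, v) ∈ B
    · obtain ⟨T, hTM, hTe⟩ := mem_biUnion.1 he
      have hTuv := mk_mem_innerPairs.1 hTe
      refine ⟨Sum.inl ⟨T, hTM⟩, ⟨hTuv.1, hTuv.2.1⟩, ?_⟩
      rintro (T' | e) h
      · congr 1
        refine Subtype.ext (hM.elim T'.2 hTM (not_disjoint_iff.2 ⟨s(u, v), ?_, hTe⟩))
        exact mk_mem_innerPairs.2 ⟨h.1, h.2, huv.ne⟩
      · exact absurd (hinr e h ▸ he) (mem_sdiff.1 e.2).2
    · have heU : s(u, v) ∈ U := mem_sdiff.2 ⟨by simpa using huv, he⟩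
      refine ⟨Sum.inr ⟨s(u, v), heU⟩, by simp, ?_⟩
      rintro (T | e) h
      · exact absurd (mem_biUnion.2 ⟨T.1, T.2, mk_mem_innerPairs.2 ⟨h.1, h.2, huv.ne⟩⟩) he
      · exact congrArg Sum.inr (Subtype.ext (hinr e h))

section FracDecomp

variable {V : Type*} [Fintype V] [DecidableEq V] {G : SimpleGraph V}

lemma IsFracDecomp.load_innerPairs {k : ℕ} {w : Finset V → ℝ} (hw : IsFracDecomp G k w)
    {u v : V} (huv : G.Adj u v) : load innerPairs w s(u, v) = 1 := by
  simp only [load, mk_mem_innerPairs, huv.ne, ne_eq, not_false_eq_true, and_true]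
  exact hw.2.2 u v huv

lemma IsFracDecomp.load_innerPairs_le_one {k : ℕ} {w : Finset V → ℝ} (hw : IsFracDecomp G k w)
    (e : Sym2 V) : load innerPairs w e ≤ 1 := by
  induction e with | _ u v
  by_cases huv : G.Adj u v
  · exact (hw.load_innerPairs huv).le
  · refine (sum_eq_zero fun C hC => ?_).trans_le zero_le_one
    rw [mem_filter, mk_mem_innerPairs] at hC
    by_contra h
    exact huv ((hw.2.1 C h).1 hC.2.1 hC.2.2.1 hC.2.2.2)

lemma IsFracDecomp.isFracMatching [DecidableRel G.Adj] {k : ℕ} {w : Finset V → ℝ}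
    (hw : IsFracDecomp G k w) :
    IsFracMatching (fun T : G.cliqueFinset 3 => innerPairs T.1) fun T => w T.1 := by
  refine ⟨fun T => hw.1 _, fun e => (hw.load_innerPairs_le_one e).trans' ?_⟩
  simp only [load, sum_filter]
  rw [sum_coe_sort (G.cliqueFinset 3) fun T => if e ∈ innerPairs T then w T else 0]
  exact sum_le_sum_of_subset_of_nonneg (subset_univ _) fun T _ _ => by
    split_ifs
    exacts [hw.1 T, le_rfl]

/-- A part of order `s ≤ 3` has weight twice the number of its edges, less three for a triangle. -/
lemma IsFracDecomp.two_mul_card_sub_le [DecidableRel G.Adj] {w : Finset V → ℝ}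
    (hw : IsFracDecomp G 3 w) :
    2 * (#G.edgeFinset : ℝ) - 3 * ∑ T : G.cliqueFinset 3, w T.1 ≤ fracWeight w := by
  have hedges : (#G.edgeFinset : ℝ) ≤ ∑ C, w C * #(innerPairs C) := by
    have h1 := sum_mul_load innerPairs w fun _ => 1
    simp only [one_mul, sum_const, nsmul_eq_mul, mul_one] at h1
    rw [← h1, card_eq_sum_ones, Nat.cast_sum]
    refine (sum_le_sum fun e he => ?_).trans
      (sum_le_sum_of_subset_of_nonneg (subset_univ G.edgeFinset) fun e _ _ =>
        load_nonneg hw.1 e)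
    induction e with | _ u v
    rw [hw.load_innerPairs (by simpa using he), Nat.cast_one]
  have hpart (C : Finset V) : 2 * (w C * #(innerPairs C))
      ≤ w C * #C + 3 * if C ∈ G.cliqueFinset 3 then w C else 0 := by
    by_cases h0 : w C = 0
    · simp [h0]
    obtain ⟨hclique, hle⟩ := hw.2.1 C h0
    have hC := hw.1 C
    obtain h | h | h | h : #C = 0 ∨ #C = 1 ∨ #C = 2 ∨ #C = 3 := by omega
    · obtain rfl := card_eq_zero.1 h
      simp [innerPairs]
    · obtain ⟨x, rfl⟩ := card_eq_one.1 h
      have : ({x} : Finset V) ∉ G.cliqueFinset 3 := by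
        simp [SimpleGraph.mem_cliqueFinset_iff, SimpleGraph.isNClique_iff]
      simp [innerPairs, this, hC]
    · obtain ⟨x, y, hxy, rfl⟩ := card_eq_two.1 h
      have h1 : #(innerPairs ({x, y} : Finset V)) ≤ 1 := by
        refine card_le_one.2 fun e he f hf => ?_
        induction e with | _ a b
        induction f with | _ c d
        rw [mk_mem_innerPairs] at he hf
        rw [Sym2.eq_iff]
        grind
      have h2 : (#(innerPairs ({x, y} : Finset V)) : ℝ) ≤ 1 := by exact_mod_cast h1
      rw [h]
      split_ifs <;> push_cast <;> nlinarith
    · rw [if_pos (SimpleGraph.mem_cliqueFinset_iff.2 ⟨hclique, h⟩),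
        card_innerPairs_of_card_eq_three h, h]
      push_cast
      linarith
  have hsum := sum_le_sum fun C (_ : C ∈ univ) => hpart C
  rw [sum_add_distrib, ← mul_sum, ← mul_sum, sum_ite_mem, univ_inter,
    ← sum_coe_sort (G.cliqueFinset 3) w] at hsum
  unfold fracWeight
  linarith

open Classical in
/-- Weight one on every edge is a fractional decomposition. -/
lemma isFracDecomp_edges {k : ℕ} (hk : 2 ≤ k) :
    IsFracDecomp G k fun C => if G.IsClique (C : Set V) ∧ #C = 2 then 1 else 0 := by
  refine ⟨fun C => by dsimp only; split_ifs <;> norm_num, fun C hC => ?_, fun u v huv => ?_⟩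
  · obtain ⟨h1, h2⟩ := (ite_ne_right_iff.1 hC).1
    exact ⟨h1, h2.trans_le hk⟩
  · have hclique : G.IsClique (({u, v} : Finset V) : Set V) := by
      simpa [SimpleGraph.isClique_pair] using fun _ => huv
    rw [sum_eq_single_of_mem {u, v} (by simp), if_pos ⟨hclique, card_pair huv.ne⟩]
    rintro C hC hne
    refine if_neg fun h => hne ?_
    rw [mem_filter] at hC
    refine (eq_of_subset_of_card_le ?_ ?_).symm
    · grind
    · rw [h.2, card_pair huv.ne]

end FracDecomp

open Classical in
lemma exists_piInt_le_piFrac_add {ε : ℝ} (hε : 0 < ε) :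
    ∃ N : ℕ, ∀ (V : Type) [Fintype V] (G : SimpleGraph V), N ≤ Fintype.card V →
      (piInt G 3 : ℝ) ≤ piFrac G 3 + ε * (Fintype.card V : ℝ) ^ 2 := by
  obtain ⟨N, hN⟩ := exists_triangle_packing_of_isFracMatching (ε := ε / 3) (by positivity)
  refine ⟨N, fun V _ G hV => ?_⟩
  rw [← sub_le_iff_le_add]
  refine le_csInf ⟨_, _, isFracDecomp_edges (by norm_num), rfl⟩ ?_
  rintro _ ⟨w, hw, rfl⟩
  obtain ⟨M, hM, hcard⟩ := hN V G hV _ hw.isFracMatching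
  have h1 : (piInt G 3 : ℝ) + 3 * #M ≤ 2 * #G.edgeFinset := by
    exact_mod_cast piInt_add_three_mul_card_le hM
  have h2 := hw.two_mul_card_sub_le
  linarith

/-- For every `ε > 0` there is `N` such that every graph `G` on `n ≥ N` vertices
satisfies `π₃(G) ≤ π_{3,f}(G) + εn²`. -/
theorem piInt_le_piFrac_add_littleo :
    ∀ ε : ℝ, 0 < ε → ∃ N : ℕ, ∀ n : ℕ, N ≤ n → ∀ G : SimpleGraph (Fin n),
      (piInt G 3 : ℝ) ≤ piFrac G 3 + ε * (n : ℝ) ^ 2 := by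
  intro ε hε
  obtain ⟨N, hN⟩ := exists_piInt_le_piFrac_add hε
  refine ⟨N, fun n hn G => ?_⟩
  convert hN (Fin n) G (by simpa using hn)
  simp
end

section
/- For every ε > 0 there exists N such that every simple graph G on n ≥ N vertices satisfies π_{3,f}(G) ≤ n²/2 + ε·n²; that is, the minimum weight of a fractional 3-decomposition of an n-vertex graph is at most n²/2 + o(n²). -/
open Finset

open Matrix in
/-- Moving mass `t` from the coordinate `i` to the coordinate `j` in a quadratic form whose
matrix is symmetric with zero diagonal. -/
theorem quadraticForm_transfer {V : Type*} [Fintype V] [DecidableEq V] (X : Matrix V V ℝ)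
    (hsymm : ∀ i j, X i j = X j i) (hdiag : ∀ i, X i i = 0) (z : V → ℝ) (i j : V) (t : ℝ) :
    (z + t • (Pi.single j 1 - Pi.single i 1)) ⬝ᵥ
        (X *ᵥ (z + t • (Pi.single j 1 - Pi.single i 1))) =
      z ⬝ᵥ (X *ᵥ z) + 2 * t * ((X *ᵥ z) j - (X *ᵥ z) i) - 2 * t ^ 2 * X i j := by
  have hcol : ∀ k, z ⬝ᵥ X.col k = (X *ᵥ z) k := by
    intro k
    simp only [dotProduct, mulVec, col_apply]
    exact sum_congr rfl fun l _ => by rw [hsymm l k, mul_comm]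
  simp only [mulVec_add, mulVec_smul, mulVec_sub, mulVec_single_one, dotProduct_add,
    add_dotProduct, smul_dotProduct, dotProduct_smul, sub_dotProduct, dotProduct_sub,
    single_one_dotProduct, smul_eq_mul, hcol, col_apply, hdiag,
    hsymm j i]
  ring

open Matrix in
/-- A weighted Turán-type inequality, in Motzkin–Straus form: if the weights of pairs are at most
`2` and those of positive triangles sum to at most `3`, then the associated quadratic form is at
most `1` on the standard simplex. -/
theorem quadraticForm_le_one {V : Type*} [Fintype V] [DecidableEq V] (X : Matrix V V ℝ)
    (hsymm : ∀ i j, X i j = X j i) (hdiag : ∀ i, X i i = 0) (hnonneg : ∀ i j, 0 ≤ X i j)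
    (hedge : ∀ i j, X i j ≤ 2)
    (htri : ∀ i j k, 0 < X i j → 0 < X j k → 0 < X i k → X i j + X j k + X i k ≤ 3)
    (z : V → ℝ) (hz : z ∈ stdSimplex ℝ V) : z ⬝ᵥ (X *ᵥ z) ≤ 1 := by
  have hcont : Continuous fun z : V → ℝ => z ⬝ᵥ (X *ᵥ z) := by
    simp only [dotProduct, mulVec]
    fun_prop
  obtain ⟨m, hm, hmmax⟩ := (isCompact_stdSimplex ℝ V).exists_isMaxOn ⟨z, hz⟩ hcont.continuousOn
  obtain ⟨p, ⟨hp, hpmax⟩, hpmin⟩ :=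
    (measure fun z : V → ℝ => #{i | z i ≠ 0}).wf.has_min
      {p | p ∈ stdSimplex ℝ V ∧ ∀ q ∈ stdSimplex ℝ V, q ⬝ᵥ (X *ᵥ q) ≤ p ⬝ᵥ (X *ᵥ p)}
      ⟨m, hm, fun q hq => hmmax hq⟩
  refine (hpmax z hz).trans ?_
  have hp0 : ∀ i, 0 ≤ p i := hp.1
  have hp1 : ∑ i, p i = 1 := hp.2
  have hmem : ∀ i j t, i ≠ j → 0 ≤ t → t ≤ p i →
      p + t • (Pi.single j 1 - Pi.single i 1) ∈ stdSimplex ℝ V := by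
    intro i j t hij ht hti
    refine ⟨fun k => ?_, ?_⟩
    · have := hp0 k
      by_cases hki : k = i
      · subst hki
        simpa [hij] using hti
      · by_cases hkj : k = j
        · subst hkj
          simp [hki]
          linarith
        · simpa [hki, hkj] using this
    · simp [sum_add_distrib, ← mul_sum, hp1]
  have hle : ∀ i j, 0 < p i → (X *ᵥ p) j ≤ (X *ᵥ p) i := by
    intro i j hi
    by_contra! hlt
    have hij : i ≠ j := by
      rintro rfl
      exact lt_irrefl _ hlt
    set D := (X *ᵥ p) j - (X *ᵥ p) i with hD
    have hDpos : 0 < D := by linarith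
    have htpos : 0 < min (p i) (D / 4) := lt_min hi (by linarith)
    have h := hpmax _ (hmem i j _ hij htpos.le (min_le_left _ _))
    rw [quadraticForm_transfer X hsymm hdiag, ← hD] at h
    have h4 : min (p i) (D / 4) ≤ D / 4 := min_le_right _ _
    have hx := hedge i j
    set t := min (p i) (D / 4)
    nlinarith [mul_pos htpos hDpos, mul_le_mul_of_nonneg_left hx (sq_nonneg t),
      mul_le_mul_of_nonneg_left h4 htpos.le]
  have hpos : ∀ i j, i ≠ j → 0 < p i → 0 < p j → 0 < X i j := by
    intro i j hij hi hj
    by_contra! h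
    have hX : X i j = 0 := le_antisymm h (hnonneg i j)
    have heq := quadraticForm_transfer X hsymm hdiag p i j (p i)
    rw [hX, le_antisymm (hle i j hi) (hle j i hj)] at heq
    refine hpmin (p + p i • (Pi.single j 1 - Pi.single i 1))
      ⟨hmem i j _ hij hi.le le_rfl, fun q hq => ?_⟩ ?_
    · rw [heq]
      linarith [hpmax q hq]
    · refine card_lt_card ((ssubset_iff_of_subset fun k hk => ?_).2 ⟨i, ?_, ?_⟩)
      · simp only [mem_filter, mem_univ, true_and] at hk ⊢
        intro hk0
        have hki : k ≠ i := by rintro rfl; exact hi.ne' hk0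
        have hkj : k ≠ j := by rintro rfl; exact hj.ne' hk0
        simp [hki, hkj, hk0] at hk
      · simpa using hi.ne'
      · simp [hij]
  set M := p ⬝ᵥ (X *ᵥ p) with hM
  have hdeg : ∀ i, 0 < p i → (X *ᵥ p) i = M := by
    intro i hi
    rw [hM, dotProduct, ← one_mul ((X *ᵥ p) i), ← hp1, sum_mul]
    refine sum_congr rfl fun j _ => ?_
    rcases (hp0 j).eq_or_lt with h | h
    · simp [← h]
    · rw [le_antisymm (hle j i h) (hle i j hi)]
  by_cases hbig : ∃ i j, 0 < p i ∧ 0 < p j ∧ 1 < X i j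
  · obtain ⟨i, j, hi, hj, hij1⟩ := hbig
    have hij : i ≠ j := by
      rintro rfl
      linarith [hdiag i]
    have hsum : ∑ k, p k * (X i j + X i k + X j k) ≤
        ∑ k, (p k * 3 + (if k = i then p i * (2 * X i j - 3) else 0) +
          (if k = j then p j * (2 * X i j - 3) else 0)) := by
      refine sum_le_sum fun k _ => ?_
      by_cases hki : k = i
      · subst hki
        simp only [hij, hdiag, hsymm j k, if_true, if_false]
        linarith
      · by_cases hkj : k = j
        · subst hkj
          simp only [hki, hdiag, if_true, if_false]
          linarith
        · simp only [hki, hkj, if_false, add_zero]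
          rcases (hp0 k).eq_or_lt with h | h
          · simp [← h]
          · refine mul_le_mul_of_nonneg_left ?_ h.le
            linarith [htri i j k (hpos i j hij hi hj) (hpos j k (Ne.symm hkj) hj h)
              (hpos i k (Ne.symm hki) hi h)]
    have hl : ∑ k, p k * (X i j + X i k + X j k) = X i j + M + M := by
      nth_rewrite 1 [← hdeg i hi]
      rw [← hdeg j hj]
      simp only [mul_add, sum_add_distrib, ← sum_mul, hp1, mulVec, dotProduct, one_mul]
      simp only [mul_comm]
    have hr : ∑ k, (p k * 3 + (if k = i then p i * (2 * X i j - 3) else 0) +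
          (if k = j then p j * (2 * X i j - 3) else 0)) =
        3 + p i * (2 * X i j - 3) + p j * (2 * X i j - 3) := by
      simp [sum_add_distrib, ← sum_mul, hp1]
    rw [hl, hr] at hsum
    have hs : p i + p j ≤ 1 := by
      rw [← hp1, ← sum_pair hij]
      exact sum_le_sum_of_subset_of_nonneg (subset_univ _) fun k _ _ => hp0 k
    have hx2 := hedge i j
    rcases le_total (p i + p j) (1 / 2) with h | h
    · nlinarith
    · nlinarith
  · push Not at hbig
    obtain ⟨i, hi⟩ : ∃ i, 0 < p i := by
      by_contra! h
      linarith [sum_nonpos fun i (_ : i ∈ univ) => h i]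
    rw [← hdeg i hi, ← hp1, mulVec, dotProduct]
    refine sum_le_sum fun k _ => ?_
    rcases (hp0 k).eq_or_lt with h | h
    · simp [← h]
    · nlinarith [hbig i k hi h]

/-- A form of linear programming duality for covering-type constraints: a bound on the dual
program yields a primal solution of at most that cost. -/
theorem exists_primal_of_dual_bound {K E : Type*} [Fintype K] [Fintype E] [DecidableEq K]
    [DecidableEq E] (S : Finset K) (A : K → E → ℝ) (b : E → ℝ) (c : K → ℝ) (β : ℝ)
    (hA : ∀ k e, 0 ≤ A k e) (hc : ∀ k ∈ S, 0 ≤ c k)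
    (hcover : ∀ k ∈ S, ∃ e, A k e = 1 ∧ b e = 1)
    (hdual : ∀ y : E → ℝ, (∀ k ∈ S, ∑ e, A k e * y e ≤ c k) → ∑ e, b e * y e ≤ β) :
    ∃ w : K → ℝ, (∀ k, 0 ≤ w k) ∧ (∀ k ∉ S, w k = 0) ∧ (∀ e, ∑ k, w k * A k e = b e) ∧
      ∑ k, w k * c k ≤ β := by
  by_contra hno
  have : Nonempty E := by
    by_contra hE
    rw [not_nonempty_iff] at hE
    exact hno ⟨0, by simp, by simp, isEmptyElim, by simpa using hdual 0 (by simpa using hc)⟩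
  let L : (K → ℝ) →ₗ[ℝ] (E → ℝ) × ℝ :=
    (LinearMap.pi fun e => ∑ k, A k e • LinearMap.proj k).prod (∑ k, c k • LinearMap.proj k)
  have hL1 : ∀ w e, (L w).1 e = ∑ k, w k * A k e := by
    intro w e
    simp [L, mul_comm]
  have hL2 : ∀ w, (L w).2 = ∑ k, w k * c k := by
    intro w
    simp [L, mul_comm]
  let box : Set (K → ℝ) := Set.Icc 0 fun k => if k ∈ S then 1 else 0
  have hdisj : Disjoint (L '' box) ({b} ×ˢ Set.Iic β) := by
    rw [Set.disjoint_left]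
    rintro _ ⟨w, hw, rfl⟩ hmem
    refine hno ⟨w, hw.1, fun k hk => ?_, fun e => ?_, ?_⟩
    · refine le_antisymm ?_ (hw.1 k)
      simpa [hk] using hw.2 k
    · rw [← hL1, hmem.1]
    · rw [← hL2]
      exact hmem.2
  obtain ⟨f, u, v, hfa, huv, hfb⟩ := geometric_hahn_banach_compact_closed
    ((convex_Icc _ _).linear_image L)
    (isCompact_Icc.image L.continuous_of_finiteDimensional)
    ((convex_singleton b).prod (convex_Iic β)) (isClosed_singleton.prod isClosed_Iic) hdisj
  set y : E → ℝ := fun e => f (Pi.single e 1, 0) with hy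
  set μ : ℝ := f (0, 1) with hμ
  have hf : ∀ q : (E → ℝ) × ℝ, f q = ∑ e, q.1 e * y e + q.2 * μ := by
    intro q
    have hq : q = ∑ e, q.1 e • ((Pi.single e 1 : E → ℝ), (0 : ℝ)) +
        q.2 • ((0 : E → ℝ), (1 : ℝ)) := by
      ext i
      · simp [Prod.fst_sum, Finset.sum_apply, Pi.single_apply]
      · simp [Prod.snd_sum]
    conv_lhs => rw [hq]
    simp only [hy, hμ, map_add, map_sum, map_smul, smul_eq_mul]
  have hsep : ∀ w ∈ box, ∀ r ≤ β,
      ∑ k, w k * (∑ e, A k e * y e + c k * μ) < ∑ e, b e * y e + r * μ := by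
    intro w hw r hr
    have h1 := hfa _ (Set.mem_image_of_mem L hw)
    have h2 := hfb (b, r) ⟨rfl, hr⟩
    rw [hf] at h1 h2
    have h3 : ∑ k, w k * (∑ e, A k e * y e + c k * μ) =
        ∑ e, (L w).1 e * y e + (L w).2 * μ := by
      simp only [hL1, hL2, mul_add, sum_add_distrib, sum_mul, mul_sum]
      rw [sum_comm]
      simp only [mul_assoc]
    rw [h3]
    exact h1.trans (huv.trans h2)
  have hzero : (0 : K → ℝ) ∈ box := by
    refine ⟨le_rfl, fun k => ?_⟩
    simp only [Pi.zero_apply]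
    split_ifs <;> norm_num
  have hμ0 : μ ≤ 0 := by
    by_contra! hpos
    have h := hsep 0 hzero (min β (-(∑ e, b e * y e) / μ)) (min_le_left _ _)
    have h2 : min β (-(∑ e, b e * y e) / μ) * μ ≤ -(∑ e, b e * y e) :=
      (mul_le_mul_of_nonneg_right (min_le_right _ _) hpos.le).trans
        (div_mul_cancel₀ _ hpos.ne').le
    simp only [Pi.zero_apply, zero_mul, sum_const_zero] at h
    linarith
  obtain ⟨ν, hν⟩ : ∃ ν, ν = -μ := ⟨_, rfl⟩
  have hν0 : 0 ≤ ν := by linarith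
  let exc : K → ℝ := fun k => max 0 (∑ e, A k e * y e - ν * c k)
  have hexc0 : ∀ k, 0 ≤ exc k := fun k => le_max_left _ _
  have hexc : ∑ k ∈ S, exc k < ∑ e, b e * y e - ν * β := by
    have h := hsep (fun k => if k ∈ S ∧ 0 ≤ ∑ e, A k e * y e - ν * c k then 1 else 0) ?_ β le_rfl
    · have hμν : μ = -ν := by linarith
      refine lt_of_eq_of_lt ?_ (h.trans_eq (by rw [hμν]; ring))
      rw [← sum_subset (subset_univ S) fun k _ hk => by simp [hk]]
      refine sum_congr rfl fun k hk => ?_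
      by_cases h0 : 0 ≤ ∑ e, A k e * y e - ν * c k
      · simp only [exc, max_eq_right h0, hk, h0, and_self, if_true, hμν]
        ring
      · simp only [exc, max_eq_left (not_le.1 h0).le, h0, and_false, if_false, zero_mul]
    · refine ⟨fun k => ?_, fun k => ?_⟩
      · simp only [Pi.zero_apply]
        split_ifs <;> norm_num
      · by_cases hk : k ∈ S
        · simp only [hk, true_and, if_true]
          split_ifs <;> norm_num
        · simp [hk]
  choose! a haA hab using hcover
  let y' : E → ℝ := fun e => y e - ∑ k ∈ S, if e = a k then exc k else 0
  have hy' : ∀ g : E → ℝ, ∑ e, g e * y' e = ∑ e, g e * y e - ∑ k ∈ S, g (a k) * exc k := by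
    intro g
    simp only [y', mul_sub, sum_sub_distrib, mul_sum]
    rw [sum_comm (s := univ)]
    simp
  have hfeas : ∀ k ∈ S, ∑ e, A k e * y' e ≤ ν * c k := by
    intro k hk
    rw [hy']
    have h1 : exc k ≤ ∑ l ∈ S, A k (a l) * exc l := by
      have := single_le_sum (f := fun l => A k (a l) * exc l)
        (fun l _ => mul_nonneg (hA k (a l)) (hexc0 l)) hk
      simpa [haA k hk] using this
    have h2 : ∑ e, A k e * y e - ν * c k ≤ exc k := le_max_right _ _
    linarith
  have hval : ν * β < ∑ e, b e * y' e := by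
    have h : ∑ k ∈ S, b (a k) * exc k = ∑ k ∈ S, exc k :=
      sum_congr rfl fun k hk => by rw [hab k hk, one_mul]
    rw [hy', h]
    linarith
  have hscale : ∀ t : ℝ, 0 ≤ t → t * ν ≤ 1 → t * ∑ e, b e * y' e ≤ β := by
    intro t ht htν
    have h := hdual (fun e => t * y' e) fun k hk => ?_
    · simpa only [mul_left_comm _ t, ← mul_sum] using h
    · simp only [mul_left_comm _ t, ← mul_sum]
      nlinarith [mul_le_mul_of_nonneg_left (hfeas k hk) ht,
        mul_le_mul_of_nonneg_right htν (hc k hk)]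
  rcases hν0.eq_or_lt with h0 | hpos
  · rw [← h0, zero_mul] at hval
    have h := hscale ((|β| + 1) / ∑ e, b e * y' e) (by positivity) (by simp [← h0])
    rw [div_mul_cancel₀ _ hval.ne'] at h
    linarith [le_abs_self β]
  · have h := hscale (1 / ν) (by positivity) (by rw [one_div_mul_cancel hpos.ne'])
    rw [one_div, inv_mul_le_iff₀ hpos] at h
    linarith

theorem sum_offDiag_pair {V : Type*} [DecidableEq V] {u v : V} (huv : u ≠ v) (y : V × V → ℝ) :
    ∑ p ∈ ({u, v} : Finset V).offDiag, y p = y (u, v) + y (v, u) := by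
  have h : ({u, v} : Finset V).offDiag = {(u, v), (v, u)} := by
    ext ⟨i, j⟩
    simp only [mem_offDiag, mem_insert, mem_singleton, Prod.mk.injEq]
    grind
  rw [h, sum_pair (by simp [huv])]

theorem sum_offDiag_triple {V : Type*} [DecidableEq V] {u v x : V} (huv : u ≠ v) (hvx : v ≠ x)
    (hux : u ≠ x) (y : V × V → ℝ) :
    ∑ p ∈ ({u, v, x} : Finset V).offDiag, y p =
      (y (u, v) + y (v, u)) + (y (v, x) + y (x, v)) + (y (u, x) + y (x, u)) := by
  have h : ({u, v, x} : Finset V).offDiag =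
      {(u, v), (v, u), (v, x), (x, v), (u, x), (x, u)} := by
    ext ⟨i, j⟩
    simp only [mem_offDiag, mem_insert, mem_singleton, Prod.mk.injEq]
    grind
  rw [h, sum_insert (by grind), sum_insert (by grind), sum_insert (by grind),
    sum_insert (by grind), sum_pair (by grind)]
  ring

/-- Every graph has a fractional `3`-decomposition of weight at most half the square of its
number of vertices. -/
theorem exists_isFracDecomp_three {V : Type*} [Fintype V] [DecidableEq V] (G : SimpleGraph V) :
    ∃ w, IsFracDecomp G 3 w ∧ fracWeight w ≤ (Fintype.card V : ℝ) ^ 2 / 2 := by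
  classical
  let S : Finset (Finset V) := {C | G.IsClique (C : Set V) ∧ (#C = 2 ∨ #C = 3)}
  have hpairS : ∀ u v, G.Adj u v → {u, v} ∈ S := by
    intro u v h
    simp only [S, mem_filter, mem_univ, true_and, card_pair h.ne, true_or, and_true]
    simpa [SimpleGraph.isClique_pair] using fun _ => h
  have htriS : ∀ u v x, G.Adj u v → G.Adj v x → G.Adj u x → {u, v, x} ∈ S := by
    intro u v x huv hvx hux
    simp only [S, mem_filter, mem_univ, true_and]
    refine ⟨?_, Or.inr (card_eq_three.2 ⟨u, v, x, huv.ne, hux.ne, hvx.ne, rfl⟩)⟩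
    have := (SimpleGraph.is3Clique_triple_iff (G := G) (a := u) (b := v) (c := x)).2
      ⟨huv, hux, hvx⟩
    exact this.isClique
  have hcover : ∀ C ∈ S, ∃ p : V × V,
      (if p ∈ C.offDiag then (1 : ℝ) else 0) = 1 ∧ (if G.Adj p.1 p.2 then (1 : ℝ) else 0) = 1 := by
    intro C hC
    simp only [S, mem_filter, mem_univ, true_and] at hC
    obtain ⟨u, hu, v, hv, huv⟩ := one_lt_card.1 (show 1 < #C by omega)
    exact ⟨(u, v), by simp [hu, hv, huv], by simp [hC.1 hu hv huv]⟩
  have hdual : ∀ y : V × V → ℝ,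
      (∀ C ∈ S, ∑ p, (if p ∈ C.offDiag then (1 : ℝ) else 0) * y p ≤ (#C : ℝ)) →
        ∑ p : V × V, (if G.Adj p.1 p.2 then (1 : ℝ) else 0) * y p ≤
          (Fintype.card V : ℝ) ^ 2 / 2 := by
    intro y hy
    simp only [ite_mul, one_mul, zero_mul, sum_ite_mem, univ_inter] at hy ⊢
    have h2 : ∀ u v, G.Adj u v → y (u, v) + y (v, u) ≤ 2 := by
      intro u v h
      have := hy _ (hpairS u v h)
      rw [card_pair h.ne, sum_offDiag_pair h.ne] at this
      exact_mod_cast this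
    have h3 : ∀ u v x, G.Adj u v → G.Adj v x → G.Adj u x →
        (y (u, v) + y (v, u)) + (y (v, x) + y (x, v)) + (y (u, x) + y (x, u)) ≤ 3 := by
      intro u v x huv hvx hux
      have := hy _ (htriS u v x huv hvx hux)
      rw [card_eq_three.2 ⟨u, v, x, huv.ne, hux.ne, hvx.ne, rfl⟩,
        sum_offDiag_triple huv.ne hvx.ne hux.ne] at this
      push_cast at this
      linarith
    let X : Matrix V V ℝ := fun u v => if G.Adj u v then max 0 (y (u, v) + y (v, u)) else 0
    have hXpos : ∀ u v, 0 < X u v → G.Adj u v ∧ X u v = y (u, v) + y (v, u) := by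
      intro u v h
      simp only [X] at h ⊢
      split_ifs at h ⊢ with hadj
      · refine ⟨hadj, max_eq_right ?_⟩
        by_contra! hneg
        rw [max_eq_left hneg.le] at h
        exact lt_irrefl _ h
      · exact absurd h (lt_irrefl _)
    rcases isEmpty_or_nonempty V with hV | hV
    · simp
    have hn : (0 : ℝ) < Fintype.card V := by exact_mod_cast Fintype.card_pos
    have hX := quadraticForm_le_one X
      (fun i j => by simp only [X, G.adj_comm i j, add_comm])
      (fun i => by simp [X])
      (fun i j => by simp only [X]; positivity)
      (fun i j => by
        simp only [X]
        split_ifs with h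
        · exact max_le (by norm_num) (h2 i j h)
        · norm_num)
      (fun i j k hij hjk hik => by
        obtain ⟨a1, b1⟩ := hXpos _ _ hij
        obtain ⟨a2, b2⟩ := hXpos _ _ hjk
        obtain ⟨a3, b3⟩ := hXpos _ _ hik
        rw [b1, b2, b3]
        exact h3 i j k a1 a2 a3)
      (fun _ => (Fintype.card V : ℝ)⁻¹)
      ⟨fun _ => by positivity, by simp [hn.ne']⟩
    have hXsum : ∑ u, ∑ v, X u v ≤ (Fintype.card V : ℝ) ^ 2 := by
      simp only [dotProduct, Matrix.mulVec, ← sum_mul, ← mul_sum] at hX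
      rw [inv_mul_le_iff₀ hn, mul_inv_le_iff₀ hn] at hX
      linarith
    have hysum : 2 * ∑ p : V × V, (if G.Adj p.1 p.2 then y p else 0) ≤ ∑ u, ∑ v, X u v := by
      rw [Fintype.sum_prod_type, two_mul]
      nth_rewrite 2 [sum_comm]
      rw [← sum_add_distrib]
      refine sum_le_sum fun u _ => ?_
      rw [← sum_add_distrib]
      refine sum_le_sum fun v _ => ?_
      simp only [X, G.adj_comm v u]
      split_ifs
      · exact le_max_right _ _
      · simp
    linarith
  obtain ⟨w, hw0, hwS, hw1, hwβ⟩ := exists_primal_of_dual_bound S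
    (fun C (p : V × V) => if p ∈ C.offDiag then 1 else 0)
    (fun p => if G.Adj p.1 p.2 then 1 else 0) (fun C => (#C : ℝ))
    ((Fintype.card V : ℝ) ^ 2 / 2) (fun C p => by positivity) (fun C _ => by positivity) hcover hdual
  refine ⟨w, ⟨hw0, fun C hC => ?_, fun u v huv => ?_⟩, hwβ⟩
  · have hCS : C ∈ S := by
      by_contra h
      exact hC (hwS C h)
    simp only [S, mem_filter, mem_univ, true_and] at hCS
    exact ⟨hCS.1, by omega⟩
  · have h := hw1 (u, v)
    simpa [huv, huv.ne, sum_filter] using h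

/-- For every `ε > 0` there is `N` such that every graph `G` on `n ≥ N` vertices
satisfies `π_{3,f}(G) ≤ n²/2 + εn²`. -/
theorem piFrac_le_half_sq :
    ∀ ε : ℝ, 0 < ε → ∃ N : ℕ, ∀ n : ℕ, N ≤ n → ∀ G : SimpleGraph (Fin n),
      piFrac G 3 ≤ (n : ℝ) ^ 2 / 2 + ε * (n : ℝ) ^ 2 := by
  intro ε hε
  refine ⟨0, fun n _ G => ?_⟩
  obtain ⟨w, hw, hle⟩ := exists_isFracDecomp_three G
  rw [Fintype.card_fin] at hle
  have hbdd : BddBelow {x | ∃ w, IsFracDecomp G 3 w ∧ fracWeight w = x} := by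
    refine ⟨0, ?_⟩
    rintro _ ⟨w, hw, rfl⟩
    exact sum_nonneg fun C _ => mul_nonneg (hw.1 C) (Nat.cast_nonneg _)
  have h : piFrac G 3 ≤ fracWeight w := csInf_le hbdd ⟨w, hw, rfl⟩
  have : 0 ≤ ε * (n : ℝ) ^ 2 := by positivity
  linarith
end
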